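/- arXiv:1802.09449 — 2 statements merged into one kernel-verified Lean document; each statement's English description precedes it below -/
import Mathlib

section
/- Let p > 5 be a prime, G = PSL₂(p), and let A ⊆ G be a maximal coclique which is not the underlying set of a maximal subgroup of G. Suppose A contains an element x of order greater than 2 whose order divides p − 1. If G contains A₄ as a maximal subgroup, then |A| ≤ (17/2)(p − 1), i.e. 2·|A| ≤ 17(p − 1). -/
open scoped MatrixGroups

/-- A subset `A` of a group `G` is a *coclique* if any two of its elements
generate a proper subgroup of `G`. -/
def IsCoclique {G : Type*} [Group G] (A : Set G) : Prop :=
  ∀ g ∈ A, ∀ h ∈ A, Subgroup.closure {g, h} ≠ ⊤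

/-- A coclique is *maximal* if the only coclique containing it is itself. -/
def IsMaximalCoclique {G : Type*} [Group G] (A : Set G) : Prop :=
  IsCoclique A ∧ ∀ B : Set G, IsCoclique B → A ⊆ B → A = B

/-- `G` contains a maximal subgroup isomorphic to `H`. -/
def HasMaximalSubgroupIsoTo (G : Type*) [Group G] (H : Type*) [Group H] : Prop :=
  ∃ M : Subgroup G, IsCoatom M ∧ Nonempty (M ≃* H)

namespace CocliqueBound

/-! ### Two-by-two matrices of determinant one -/

section Basic

variable {F : Type*} [Field F]

/-- The trace of an element of `SL(2, F)`. -/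
def tr (X : SL(2, F)) : F := X 0 0 + X 1 1

/-- The determinant of the additive commutator `X * Y - Y * X`. -/
def comDet (X Y : SL(2, F)) : F := (X.1 * Y.1 - Y.1 * X.1).det

/-- The element of `SL(2, F)` with given rows `(a, b)` and `(c, d)`. -/
def ofEntries (a b c d : F) (h : a * d - b * c = 1) : SL(2, F) :=
  ⟨!![a, b; c, d], by rw [Matrix.det_fin_two_of, h]⟩

section
variable (a b c d : F) (h : a * d - b * c = 1)
@[simp] lemma ofEntries_00 : (ofEntries a b c d h) 0 0 = a := rfl
@[simp] lemma ofEntries_01 : (ofEntries a b c d h) 0 1 = b := rfl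
@[simp] lemma ofEntries_10 : (ofEntries a b c d h) 1 0 = c := rfl
@[simp] lemma ofEntries_11 : (ofEntries a b c d h) 1 1 = d := rfl
end

lemma det_eq (X : SL(2, F)) : X 0 0 * X 1 1 - X 0 1 * X 1 0 = 1 := by
  rw [← Matrix.det_fin_two]; exact X.2

lemma sl_ext {X Y : SL(2, F)} (h₁ : X 0 0 = Y 0 0) (h₂ : X 0 1 = Y 0 1) (h₃ : X 1 0 = Y 1 0)
    (h₄ : X 1 1 = Y 1 1) : X = Y := by
  ext i j
  fin_cases i <;> fin_cases j <;> assumption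

lemma mul_00 (X Y : SL(2, F)) : (X * Y) 0 0 = X 0 0 * Y 0 0 + X 0 1 * Y 1 0 := by
  simp [Matrix.mul_apply]
lemma mul_01 (X Y : SL(2, F)) : (X * Y) 0 1 = X 0 0 * Y 0 1 + X 0 1 * Y 1 1 := by
  simp [Matrix.mul_apply]
lemma mul_10 (X Y : SL(2, F)) : (X * Y) 1 0 = X 1 0 * Y 0 0 + X 1 1 * Y 1 0 := by
  simp [Matrix.mul_apply]
lemma mul_11 (X Y : SL(2, F)) : (X * Y) 1 1 = X 1 0 * Y 0 1 + X 1 1 * Y 1 1 := by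
  simp [Matrix.mul_apply]
lemma inv_00 (X : SL(2, F)) : X⁻¹ 0 0 = X 1 1 := by
  rw [Matrix.SpecialLinearGroup.SL2_inv_expl]; rfl
lemma inv_01 (X : SL(2, F)) : X⁻¹ 0 1 = -X 0 1 := by
  rw [Matrix.SpecialLinearGroup.SL2_inv_expl]; rfl
lemma inv_10 (X : SL(2, F)) : X⁻¹ 1 0 = -X 1 0 := by
  rw [Matrix.SpecialLinearGroup.SL2_inv_expl]; rfl
lemma inv_11 (X : SL(2, F)) : X⁻¹ 1 1 = X 0 0 := by
  rw [Matrix.SpecialLinearGroup.SL2_inv_expl]; rfl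
lemma one_00 : (1 : SL(2, F)) 0 0 = 1 := rfl
lemma one_01 : (1 : SL(2, F)) 0 1 = 0 := rfl
lemma one_10 : (1 : SL(2, F)) 1 0 = 0 := rfl
lemma one_11 : (1 : SL(2, F)) 1 1 = 1 := rfl
lemma neg_entry (X : SL(2, F)) (i j : Fin 2) : (-X) i j = -X i j := by simp

lemma comDet_eq (X Y : SL(2, F)) : comDet X Y = -(X 0 1 * Y 1 0 - Y 0 1 * X 1 0) ^ 2
    - ((X 0 0 - X 1 1) * Y 0 1 - (Y 0 0 - Y 1 1) * X 0 1)
      * ((Y 0 0 - Y 1 1) * X 1 0 - (X 0 0 - X 1 1) * Y 1 0) := by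
  simp only [comDet, Matrix.det_fin_two, Matrix.sub_apply, Matrix.mul_apply, Fin.sum_univ_two]
  ring

lemma comDet_conj (P X Y : SL(2, F)) : comDet (P⁻¹ * X * P) (P⁻¹ * Y * P) = comDet X Y := by
  have h : P.1 * P⁻¹.1 = 1 := by
    rw [← Matrix.SpecialLinearGroup.coe_mul, mul_inv_cancel, Matrix.SpecialLinearGroup.coe_one]
  have : (P⁻¹ * X * P).1 * (P⁻¹ * Y * P).1 - (P⁻¹ * Y * P).1 * (P⁻¹ * X * P).1 =
      P⁻¹.1 * (X.1 * Y.1 - Y.1 * X.1) * P.1 := by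
    rw [← Matrix.SpecialLinearGroup.coe_mul, ← Matrix.SpecialLinearGroup.coe_mul,
      show P⁻¹ * X * P * (P⁻¹ * Y * P) = P⁻¹ * (X * Y) * P by group,
      show P⁻¹ * Y * P * (P⁻¹ * X * P) = P⁻¹ * (Y * X) * P by group]
    simp only [Matrix.SpecialLinearGroup.coe_mul]; noncomm_ring
  rw [comDet, this, Matrix.det_mul, Matrix.det_mul, P.2, P⁻¹.2, one_mul, mul_one, comDet]

lemma tr_eq_trace (X : SL(2, F)) : tr X = X.1.trace := by rw [Matrix.trace_fin_two]; rfl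

lemma tr_mul_comm (X Y : SL(2, F)) : tr (X * Y) = tr (Y * X) := by
  rw [tr, tr, mul_00, mul_11, mul_00, mul_11]; ring

lemma tr_conj (P X : SL(2, F)) : tr (P⁻¹ * X * P) = tr X := by
  rw [tr_mul_comm, ← mul_assoc, mul_inv_cancel, one_mul]

lemma tr_neg (X : SL(2, F)) : tr (-X) = -tr X := by
  simp only [tr, neg_entry]; ring

lemma tr_inv_mul (X Y : SL(2, F)) : tr (X⁻¹ * Y) = tr X * tr Y - tr (X * Y) := by
  simp only [tr, mul_00, mul_11, inv_00, inv_01, inv_10, inv_11]; ring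

lemma tr_commutator (X Y : SL(2, F)) : tr (X * Y * X⁻¹ * Y⁻¹) = 2 - comDet X Y := by
  simp only [tr, mul_00, mul_11, mul_01, mul_10, inv_00, inv_01, inv_10, inv_11, comDet_eq]
  linear_combination (2 * (Y 0 0 * Y 1 1 - Y 0 1 * Y 1 0)) * det_eq X + 2 * det_eq Y

lemma comDet_of_commute {X Y : SL(2, F)} (h : X * Y = Y * X) : comDet X Y = 0 := by
  rw [comDet, ← Matrix.SpecialLinearGroup.coe_mul, h, Matrix.SpecialLinearGroup.coe_mul, sub_self]
  simp

/-- The Cayley--Hamilton theorem in entries. -/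
lemma sq_entries (X : SL(2, F)) :
    (X * X) 0 0 = tr X * X 0 0 - 1 ∧ (X * X) 0 1 = tr X * X 0 1 ∧
    (X * X) 1 0 = tr X * X 1 0 ∧ (X * X) 1 1 = tr X * X 1 1 - 1 := by
  simp only [tr, mul_00, mul_11, mul_01, mul_10]
  refine ⟨?_, ?_, ?_, ?_⟩
  · linear_combination - det_eq X
  · ring
  · ring
  · linear_combination - det_eq X

lemma sq_of_tr_zero {X : SL(2, F)} (h : tr X = 0) : X * X = -1 := by
  obtain ⟨h₁, h₂, h₃, h₄⟩ := sq_entries X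
  apply sl_ext <;> rw [neg_entry] <;> simp_all [one_00, one_01, one_10, one_11]

lemma tr_sq (X : SL(2, F)) : tr (X * X) = tr X ^ 2 - 2 := by
  obtain ⟨h₁, h₂, h₃, h₄⟩ := sq_entries X
  rw [tr, h₁, h₄, tr]; ring

lemma eq_one_or_eq_neg_one {X : SL(2, F)} (h₁ : X 0 1 = 0) (h₂ : X 1 0 = 0)
    (h₃ : X 0 0 = X 1 1) : X = 1 ∨ X = -1 := by
  have h := det_eq X
  rw [h₁, h₃] at h
  have : X 1 1 = 1 ∨ X 1 1 = -1 := mul_self_eq_one_iff.mp (by linear_combination h)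
  rcases this with h | h
  · left; apply sl_ext <;> simp_all
  · right; apply sl_ext <;> simp_all

lemma tr_zero_of_sq {X : SL(2, F)} (h : X * X = -1) : tr X = 0 := by
  obtain ⟨h₁, h₂, h₃, h₄⟩ := sq_entries X
  by_contra ht
  rw [h, neg_entry] at h₁ h₂ h₃ h₄
  rw [one_00] at h₁; rw [one_01] at h₂; rw [one_10] at h₃; rw [one_11] at h₄
  have := det_eq X
  grind

lemma eq_of_sq_eq_one {X : SL(2, F)} (h2 : (2 : F) ≠ 0) (h : X * X = 1) : X = 1 ∨ X = -1 := by
  obtain ⟨h₁, h₂, h₃, h₄⟩ := sq_entries X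
  rw [h] at h₁ h₂ h₃ h₄
  rw [one_00] at h₁; rw [one_01] at h₂; rw [one_10] at h₃; rw [one_11] at h₄
  have ht : tr X ≠ 0 := by intro ht; rw [ht] at h₁; apply h2; linear_combination h₁
  apply eq_one_or_eq_neg_one
  · simpa [ht, eq_comm] using h₂
  · simpa [ht, eq_comm] using h₃
  · exact mul_left_cancel₀ ht (by linear_combination h₄ - h₁)

lemma mem_center {X : SL(2, F)} :
    X ∈ Subgroup.center (SL(2, F)) ↔ X = 1 ∨ X = -1 := by
  constructor
  · rw [Matrix.SpecialLinearGroup.mem_center_iff]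
    rintro ⟨r, -, hr⟩
    have h : ∀ i j, X i j = Matrix.scalar (Fin 2) r i j := fun i j ↦ by rw [hr]
    apply eq_one_or_eq_neg_one <;> simp [h]
  · rintro (rfl | rfl)
    · exact one_mem _
    · rw [Subgroup.mem_center_iff]; intro g
      rw [mul_neg, neg_mul, mul_one, one_mul]

lemma neg_one_ne_one (h2 : (2 : F) ≠ 0) : (-1 : SL(2, F)) ≠ 1 := by
  intro h
  have := congr_arg (fun X : SL(2, F) ↦ X 0 0) h
  simp only [neg_entry, one_00] at this
  exact h2 (by linear_combination -this)

end Basic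

/-! ### Unipotent elements and Borel subgroups -/

section Borel

variable {F : Type*} [Field F]

/-- The upper unitriangular matrix with entry `t`. -/
def upper (t : F) : SL(2, F) := ofEntries 1 t 0 1 (by ring)

/-- The lower unitriangular matrix with entry `t`. -/
def lower (t : F) : SL(2, F) := ofEntries 1 0 t 1 (by ring)

/-- The subgroup of upper triangular matrices, conjugated by `P`. -/
def borel (P : SL(2, F)) : Subgroup SL(2, F) where
  carrier := {X | (P⁻¹ * X * P) 1 0 = 0}
  one_mem' := by
    show (P⁻¹ * 1 * P) 1 0 = 0
    rw [mul_one, inv_mul_cancel, one_10]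
  mul_mem' {X Y} hX hY := by
    show (P⁻¹ * (X * Y) * P) 1 0 = 0
    rw [show P⁻¹ * (X * Y) * P = (P⁻¹ * X * P) * (P⁻¹ * Y * P) by group, mul_10,
      show (P⁻¹ * X * P) 1 0 = 0 from hX, show (P⁻¹ * Y * P) 1 0 = 0 from hY]
    ring
  inv_mem' {X} hX := by
    show (P⁻¹ * X⁻¹ * P) 1 0 = 0
    rw [show P⁻¹ * X⁻¹ * P = (P⁻¹ * X * P)⁻¹ by group, inv_10,
      show (P⁻¹ * X * P) 1 0 = 0 from hX, neg_zero]

lemma mem_borel {P X : SL(2, F)} : X ∈ borel P ↔ (P⁻¹ * X * P) 1 0 = 0 := Iff.rfl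

lemma upper_pow (t : F) (n : ℕ) : upper t ^ n = upper (n * t) := by
  induction n with
  | zero => rw [pow_zero]; apply sl_ext <;> simp [upper]
  | succ n ih =>
    rw [pow_succ, ih]
    apply sl_ext <;> simp only [mul_00, mul_01, mul_10, mul_11] <;> simp [upper]
    ring

/-- A matrix with an eigenvalue in the field can be conjugated into upper triangular form. -/
lemma exists_conj_upper {X : SL(2, F)} {l : F} (hl : l ^ 2 - tr X * l + 1 = 0) :
    ∃ P : SL(2, F), (P⁻¹ * X * P) 1 0 = 0 := by
  by_cases h : X 1 0 = 0
  · exact ⟨1, by simpa using h⟩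
  · refine ⟨ofEntries ((l - X 1 1) / X 1 0) (-1) 1 0 (by ring), ?_⟩
    rw [mul_10, mul_10, mul_11, inv_10, inv_11]
    have hd := det_eq X
    rw [tr] at hl
    simp only [ofEntries_00, ofEntries_10]
    field_simp
    linear_combination hl + hd

end Borel

section Generation

variable {p : ℕ} [Fact p.Prime]

/-- A nontrivial upper unipotent and a matrix that is not upper triangular generate
the special linear group over a prime field. -/
lemma eq_top_of_upper_mem {H : Subgroup SL(2, ZMod p)} {s : ZMod p} (hs : s ≠ 0)
    (hu : upper s ∈ H) {h : SL(2, ZMod p)} (hh : h ∈ H) (hc : h 1 0 ≠ 0) : H = ⊤ := by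
  have hU (t : ZMod p) : upper t ∈ H := by
    have := H.pow_mem hu (t / s).val
    rwa [upper_pow, ZMod.natCast_val, ZMod.cast_id, div_mul_cancel₀ _ hs] at this
  set c := h 1 0 with hc'
  have hd := det_eq h
  have hW : upper (-h 0 0 / c) * h * upper (-h 1 1 / c) ∈ H :=
    H.mul_mem (H.mul_mem (hU _) hh) (hU _)
  set W := upper (-h 0 0 / c) * h * upper (-h 1 1 / c) with hWdef
  have h00 : W 0 0 = 0 := by
    simp only [hWdef, mul_00, mul_01, ← hc']; simp [upper]; field_simp; ring
  have h10 : W 1 0 = c := by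
    simp only [hWdef, mul_10, mul_11, ← hc']; simp [upper]
  have h11 : W 1 1 = 0 := by
    simp only [hWdef, mul_10, mul_11, ← hc']; simp [upper]; field_simp; ring
  have h01 : W 0 1 = -1 / c := by
    have := det_eq W
    rw [h00, h10] at this
    field_simp
    linear_combination -this
  have hL (t : ZMod p) : lower t ∈ H := by
    have := H.mul_mem (H.mul_mem hW (hU (-t / c ^ 2))) (H.inv_mem hW)
    convert this
    apply sl_ext <;>
      simp only [mul_00, mul_01, mul_10, mul_11, inv_00, inv_01, inv_10, inv_11, h00, h01, h10,
        h11] <;> simp [upper, lower] <;> field_simp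
  have key (g : SL(2, ZMod p)) (hg : g 1 0 ≠ 0) : g ∈ H := by
    have := H.mul_mem (H.mul_mem (hU ((g 0 0 - 1) / g 1 0)) (hL (g 1 0)))
      (hU ((g 1 1 - 1) / g 1 0))
    convert this
    have hgd := det_eq g
    apply sl_ext <;> simp only [mul_00, mul_01, mul_10, mul_11] <;> simp [upper, lower] <;>
      field_simp <;> grind
  rw [Subgroup.eq_top_iff']
  intro g
  by_cases hg : g 1 0 = 0
  · have h1 : (g * lower 1 : SL(2, ZMod p)) 1 0 ≠ 0 := by
      have hgd := det_eq g
      rw [mul_10, hg]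
      simp only [lower, ofEntries_00, ofEntries_10]
      intro h0
      rw [hg] at hgd
      simp at h0
      simp [h0] at hgd
    have := H.mul_mem (key _ h1) (H.inv_mem (hL 1))
    rwa [mul_inv_cancel_right] at this
  · exact key g hg

lemma eq_top_of_conj_upper_mem {H : Subgroup SL(2, ZMod p)} {P : SL(2, ZMod p)} {s : ZMod p}
    (hs : s ≠ 0) (hu : P * upper s * P⁻¹ ∈ H) {h : SL(2, ZMod p)} (hh : h ∈ H)
    (hc : h ∉ borel P) : H = ⊤ := by
  have : H.comap (MulAut.conj P).toMonoidHom = ⊤ := by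
    apply eq_top_of_upper_mem hs (h := P⁻¹ * h * P)
    · simpa [Subgroup.mem_comap] using hu
    · simpa [Subgroup.mem_comap, mul_assoc] using hh
    · rwa [mem_borel] at hc
  rw [Subgroup.eq_top_iff'] at this ⊢
  intro g
  have := this (P⁻¹ * g * P)
  simpa [Subgroup.mem_comap, mul_assoc] using this

lemma conj_upper_mem_borel (P : SL(2, ZMod p)) (s : ZMod p) : P * upper s * P⁻¹ ∈ borel P := by
  rw [mem_borel, show P⁻¹ * (P * upper s * P⁻¹) * P = upper s by group]
  rfl

/-- The images of the Borel subgroups in `PSL(2, ZMod p)` are maximal subgroups. -/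
lemma isCoatom_map_borel (P : SL(2, ZMod p)) :
    IsCoatom ((borel P).map (QuotientGroup.mk' (Subgroup.center SL(2, ZMod p)))) := by
  set π := QuotientGroup.mk' (Subgroup.center SL(2, ZMod p)) with hπ
  have hker : π.ker ≤ borel P := by
    intro X hX
    rw [hπ, QuotientGroup.ker_mk', mem_center] at hX
    rw [mem_borel]
    rcases hX with rfl | rfl
    · simp [one_10]
    · rw [mul_neg, neg_mul, neg_entry, mul_one, inv_mul_cancel, one_10, neg_zero]
  have hcomap : ((borel P).map π).comap π = borel P := Subgroup.comap_map_eq_self hker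
  constructor
  · intro htop
    rw [htop, Subgroup.comap_top] at hcomap
    have : P * lower 1 * P⁻¹ ∈ borel P := hcomap ▸ Subgroup.mem_top _
    rw [mem_borel, show P⁻¹ * (P * lower 1 * P⁻¹) * P = lower 1 by group] at this
    simp [lower] at this
  · intro K hK
    have hle : borel P ≤ K.comap π := Subgroup.map_le_iff_le_comap.mp hK.le
    obtain ⟨k, hk, hkn⟩ := SetLike.exists_of_lt hK
    obtain ⟨k, rfl⟩ := QuotientGroup.mk'_surjective _ k
    have : K.comap π = ⊤ := eq_top_of_conj_upper_mem (one_ne_zero) (hle (conj_upper_mem_borel P 1))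
      (h := k) hk (fun h ↦ hkn (Subgroup.mem_map_of_mem π h))
    rw [← Subgroup.map_comap_eq_self_of_surjective (QuotientGroup.mk'_surjective _) K, ← hπ, this,
      ← MonoidHom.range_eq_map, MonoidHom.range_eq_top.mpr (QuotientGroup.mk'_surjective _)]

end Generation

/-! ### Counting fixed points -/

section Counting

lemma egyptian_sorted {n a b c : ℕ} (hn : 0 < n) (ha : 2 ≤ a) (hab : a ≤ b) (hbc : b ≤ c)
    (h : (1 / a + 1 / b + 1 / c : ℚ) = 1 + 2 / n) :
    2 * c = n ∨ (a ≤ 3 ∧ b ≤ 3 ∧ c ≤ 3) ∨ c = 4 ∨ c = 5 := by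
  have hn' : (0 : ℚ) < n := by exact_mod_cast hn
  have h2n : (0 : ℚ) < 2 / n := by positivity
  have hle {x y : ℕ} (hx : 0 < x) (hxy : x ≤ y) : (1 / y : ℚ) ≤ 1 / x :=
    one_div_le_one_div_of_le (by exact_mod_cast hx) (by exact_mod_cast hxy)
  have ha3 : a < 3 := by
    by_contra! h3
    have h₁ := hle (by norm_num) h3
    have h₂ := hle (by norm_num) (h3.trans hab)
    have h₃ := hle (by norm_num) ((h3.trans hab).trans hbc)
    norm_num at h₁ h₂ h₃ h
    linarith
  obtain rfl : a = 2 := by omega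
  have hb4 : b < 4 := by
    by_contra! h4
    have h₂ := hle (by norm_num) h4
    have h₃ := hle (by norm_num) (h4.trans hbc)
    norm_num at h₂ h₃ h
    linarith
  have hc0 : (0 : ℚ) < c := by exact_mod_cast (by omega : 0 < c)
  obtain rfl | rfl : b = 2 ∨ b = 3 := by omega
  · left
    have : (2 * c : ℚ) = n := by
      field_simp at h
      norm_num at h
      linarith
    exact_mod_cast this
  · right
    have hc6 : c < 6 := by
      by_contra! h6
      have h₃ := hle (by norm_num) h6
      norm_num at h₃ h
      linarith
    omega

lemma egyptian {n a b c : ℕ} (hn : 0 < n) (ha : 2 ≤ a) (hb : 2 ≤ b) (hc : 2 ≤ c)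
    (h : (1 / a + 1 / b + 1 / c : ℚ) = 1 + 2 / n) :
    (2 * a = n ∨ 2 * b = n ∨ 2 * c = n) ∨ (a ≤ 3 ∧ b ≤ 3 ∧ c ≤ 3) ∨
      (a = 4 ∨ b = 4 ∨ c = 4) ∨ (a = 5 ∨ b = 5 ∨ c = 5) := by
  rcases le_total a b with h₁ | h₁ <;> rcases le_total b c with h₂ | h₂ <;>
    rcases le_total a c with h₃ | h₃
  · have := egyptian_sorted hn ha h₁ h₂ h; omega
  · have := egyptian_sorted hn ha h₁ h₂ h; omega
  · have := egyptian_sorted hn ha h₃ h₂ (by rw [← h]; ring); omega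
  · have := egyptian_sorted hn hc h₃ h₁ (by rw [← h]; ring); omega
  · have := egyptian_sorted hn hb h₁ h₃ (by rw [← h]; ring); omega
  · have := egyptian_sorted hn hb h₂ h₃ (by rw [← h]; ring); omega
  · have := egyptian_sorted hn hc h₂ h₁ (by rw [← h]; ring); omega
  · have := egyptian_sorted hn hc h₂ h₁ (by rw [← h]; ring); omega

/-- The possible orders of point stabilisers for a group acting like a finite rotation group. -/
lemma rotation_orders {ι : Type*} [Fintype ι] (m : ι → ℕ) (n : ℕ) (hn : 2 ≤ n)
    (hm : ∀ i, 1 ≤ m i) (hmn : ∀ i, m i < n)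
    (h : ∑ i, (1 - 1 / (m i : ℚ)) = 2 - 2 / n) :
    (∃ i, 2 * m i = n) ∨ (∀ i, m i ≤ 3) ∨ (∃ i, m i = 4) ∨ (∃ i, m i = 5) := by
  classical
  have hn' : (2 : ℚ) ≤ n := by exact_mod_cast hn
  have h2n : (0 : ℚ) < 2 / n := by positivity
  have h2n' : (2 / n : ℚ) ≤ 1 := by rw [div_le_one (by linarith)]; exact hn'
  set T := Finset.univ.filter (fun i ↦ 2 ≤ m i) with hT
  have hmem {i : ι} (hi : i ∈ T) : 2 ≤ m i := (Finset.mem_filter.mp hi).2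
  have hsum : ∑ i ∈ T, (1 - 1 / (m i : ℚ)) = 2 - 2 / n := by
    rw [← h]
    refine Finset.sum_subset (Finset.subset_univ _) fun i _ hi ↦ ?_
    have : m i = 1 := by
      have := hm i
      have : ¬ 2 ≤ m i := fun h2 ↦ hi (Finset.mem_filter.mpr ⟨Finset.mem_univ _, h2⟩)
      omega
    rw [this]; norm_num
  have hlow : (T.card : ℚ) * (1 / 2) ≤ ∑ i ∈ T, (1 - 1 / (m i : ℚ)) := by
    rw [← nsmul_eq_mul]
    refine Finset.card_nsmul_le_sum _ _ _ fun i hi ↦ ?_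
    have := one_div_le_one_div_of_le (by norm_num) (by exact_mod_cast hmem hi : (2 : ℚ) ≤ m i)
    linarith
  have hcard : T.card ≤ 3 := by
    have : (T.card : ℚ) < 4 := by linarith
    have : T.card < 4 := by exact_mod_cast this
    omega
  have hpos (i : ι) : (1 / n : ℚ) < 1 / (m i : ℚ) :=
    one_div_lt_one_div_of_lt (by exact_mod_cast hm i) (by exact_mod_cast hmn i)
  have hnn : (2 / n : ℚ) = 1 / n + 1 / n := by ring
  have h1n : (0 : ℚ) < 1 / n := by positivity
  obtain h0 | h1 | h2 | h3 : T.card = 0 ∨ T.card = 1 ∨ T.card = 2 ∨ T.card = 3 := by omega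
  · rw [Finset.card_eq_zero.mp h0, Finset.sum_empty] at hsum
    linarith
  · obtain ⟨i, hi⟩ := Finset.card_eq_one.mp h1
    rw [hi, Finset.sum_singleton] at hsum
    have := hpos i
    linarith
  · obtain ⟨i, j, hij, hi⟩ := Finset.card_eq_two.mp h2
    rw [hi, Finset.sum_pair hij] at hsum
    have := hpos i
    have := hpos j
    linarith
  · obtain ⟨i, j, k, hij, hik, hjk, hi⟩ := Finset.card_eq_three.mp h3
    have hi2 : 2 ≤ m i := hmem (by rw [hi]; simp)
    have hj2 : 2 ≤ m j := hmem (by rw [hi]; simp)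
    have hk2 : 2 ≤ m k := hmem (by rw [hi]; simp)
    rw [hi, Finset.sum_insert (by simp [hij, hik]), Finset.sum_pair hjk] at hsum
    rcases egyptian (by omega) hi2 hj2 hk2 (n := n) (by linarith) with h | h | h | h
    · left; rcases h with h | h | h <;> exact ⟨_, h⟩
    · right; left
      intro l
      by_cases hl : l ∈ T
      · rw [hi] at hl
        simp only [Finset.mem_insert, Finset.mem_singleton] at hl
        rcases hl with rfl | rfl | rfl <;> omega
      · have : ¬ 2 ≤ m l := fun h2 ↦ hl (Finset.mem_filter.mpr ⟨Finset.mem_univ _, h2⟩)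
        omega
    · right; right; left; rcases h with h | h | h <;> exact ⟨_, h⟩
    · right; right; right; rcases h with h | h | h <;> exact ⟨_, h⟩

/-- A finite group with an involution acting trivially on a finite set, in which all other
nontrivial elements have exactly two fixed points. -/
lemma stabilizer_orders {G X : Type*} [Group G] [Finite G] [Finite X] [MulAction G X] (z : G)
    (hz1 : z ≠ 1) (hz2 : z * z = 1) (hz : ∀ x : X, z • x = x)
    (hfix : ∀ g : G, g ≠ 1 → g ≠ z → (MulAction.fixedBy X g).ncard = 2)
    (hG : 2 < Nat.card G) (hstab : ∀ x : X, MulAction.stabilizer G x ≠ ⊤) :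
    (∃ x : X, 2 * Nat.card (MulAction.stabilizer G x) = Nat.card G) ∨
    (∀ x : X, Nat.card (MulAction.stabilizer G x) ≤ 6) ∨
    (∃ x : X, Nat.card (MulAction.stabilizer G x) = 8) ∨
    (∃ x : X, Nat.card (MulAction.stabilizer G x) = 10) := by
  classical
  have := Fintype.ofFinite G
  have := Fintype.ofFinite X
  have hord : orderOf z = 2 := orderOf_eq_prime (by rw [pow_two, hz2]) hz1
  have heven (S : Subgroup G) (h : z ∈ S) : 2 ∣ Nat.card S := by
    rw [← hord]; exact Subgroup.orderOf_dvd_natCard S h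
  have hdiv (x : X) : 2 ∣ Nat.card (MulAction.stabilizer G x) := heven _ (hz x)
  obtain ⟨n, hn⟩ : 2 ∣ Nat.card G := hord ▸ orderOf_dvd_natCard z
  choose m hm using hdiv
  have hmpos (x : X) : 1 ≤ m x := by
    have : 0 < Nat.card (MulAction.stabilizer G x) := Nat.card_pos
    have := hm x
    omega
  have hlt (x : X) : m x < n := by
    have h1 := hm x
    have h2 := Subgroup.card_le_card_group (MulAction.stabilizer G x)
    have h3 : Nat.card (MulAction.stabilizer G x) ≠ Nat.card G := fun h ↦
      hstab x (Subgroup.eq_top_of_card_eq _ h)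
    omega
  have hconst {x y : X} (h : MulAction.orbitRel G X x y) : m x = m y := by
    have h1 := hm x
    have h2 := hm y
    have h3 := Nat.card_congr (MulAction.stabilizerEquivStabilizerOfOrbitRel h).toEquiv
    omega
  have hburn := MulAction.sum_card_fixedBy_eq_card_orbits_mul_card_group G X
  have hclass := MulAction.card_eq_sum_card_group_div_card_stabilizer G X
  have hfixsum : (∑ g : G, (Fintype.card (MulAction.fixedBy X g) : ℚ)) =
      2 * Fintype.card X + 2 * (Fintype.card G - 2) := by
    have h (g : G) : (Fintype.card (MulAction.fixedBy X g) : ℚ) =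
        2 + (if g = 1 then (Fintype.card X - 2 : ℚ) else 0) +
          (if g = z then (Fintype.card X - 2 : ℚ) else 0) := by
      have hall (h : ∀ x : X, g • x = x) : Fintype.card (MulAction.fixedBy X g) = Fintype.card X :=
        Fintype.card_congr (Equiv.subtypeUnivEquiv h)
      by_cases h1 : g = 1
      · rw [if_pos h1, if_neg (by rw [h1]; exact hz1.symm), hall (by simp [h1])]; ring
      · by_cases h2 : g = z
        · rw [if_neg h1, if_pos h2, hall (by rw [h2]; exact hz)]; ring
        · rw [if_neg h1, if_neg h2, ← Nat.card_eq_fintype_card, Nat.card_coe_set_eq, hfix g h1 h2]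
          norm_num
    simp only [h, Finset.sum_add_distrib, Finset.sum_ite_eq', Finset.mem_univ, if_true,
      Finset.sum_const, Finset.card_univ, nsmul_eq_mul]
    ring
  have hN : (Fintype.card G : ℚ) = 2 * n := by
    rw [← Nat.card_eq_fintype_card, hn]; push_cast; ring
  have hn0 : (n : ℚ) ≠ 0 := by
    have : n ≠ 0 := by omega
    exact_mod_cast this
  have hsum : ∑ o : Quotient (MulAction.orbitRel G X), (1 - 1 / (m o.out : ℚ)) = 2 - 2 / n := by
    have h1 : (Fintype.card X : ℚ) =
        ∑ o : Quotient (MulAction.orbitRel G X), (n : ℚ) * (1 / (m o.out : ℚ)) := by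
      rw [hclass]
      push_cast
      refine Finset.sum_congr rfl fun o _ ↦ ?_
      rw [Nat.cast_div (by
        rw [← Nat.card_eq_fintype_card, ← Nat.card_eq_fintype_card]
        exact Subgroup.card_subgroup_dvd_card _) (by exact_mod_cast Fintype.card_ne_zero),
        hN, ← Nat.card_eq_fintype_card, hm]
      have : (m o.out : ℚ) ≠ 0 := by
        have := hmpos o.out
        exact_mod_cast (by omega : m o.out ≠ 0)
      push_cast
      field_simp
    rw [← Finset.mul_sum] at h1
    have h2 : ((∑ g : G, Fintype.card (MulAction.fixedBy X g) : ℕ) : ℚ) = _ :=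
      congr_arg Nat.cast hburn
    push_cast at h2
    rw [hfixsum, hN] at h2
    rw [Finset.sum_sub_distrib, Finset.sum_const, Finset.card_univ, nsmul_eq_mul, mul_one]
    apply mul_left_cancel₀ hn0
    rw [mul_sub, ← h1]
    field_simp
    linarith
  rcases rotation_orders (fun o : Quotient (MulAction.orbitRel G X) ↦ m o.out) n (by omega)
    (fun _ ↦ hmpos _) (fun _ ↦ hlt _) hsum with ⟨o, ho⟩ | h | ⟨o, ho⟩ | ⟨o, ho⟩
  · exact .inl ⟨o.out, by rw [hm, hn, ← ho]⟩
  · refine .inr (.inl fun x ↦ ?_)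
    have h1 : m (Quotient.mk (MulAction.orbitRel G X) x).out = m x :=
      hconst (Quotient.mk_out (s := MulAction.orbitRel G X) x)
    have h2 := h (Quotient.mk (MulAction.orbitRel G X) x)
    rw [hm]
    omega
  · exact .inr (.inr (.inl ⟨o.out, by rw [hm, ho]⟩))
  · exact .inr (.inr (.inr ⟨o.out, by rw [hm, ho]⟩))

end Counting

/-! ### Proper subgroups generated by two elements -/

section Powers

variable {F : Type*} [Field F]

lemma coe_mul_self (X : SL(2, F)) : X.1 * X.1 = tr X • X.1 - 1 := by
  obtain ⟨h₁, h₂, h₃, h₄⟩ := sq_entries X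
  ext i j
  rw [← Matrix.SpecialLinearGroup.coe_mul]
  fin_cases i <;> fin_cases j <;> simp_all

lemma eq_zero_of_smul_eq_scalar {X : SL(2, F)} (h₁ : X ≠ 1) (h₂ : X ≠ -1) {a c : F}
    (h : a • X.1 = c • (1 : Matrix (Fin 2) (Fin 2) F)) : a = 0 := by
  by_contra ha
  have h00 := congr_fun₂ h 0 0
  have h01 := congr_fun₂ h 0 1
  have h10 := congr_fun₂ h 1 0
  have h11 := congr_fun₂ h 1 1
  simp at h00 h01 h10 h11
  rcases eq_one_or_eq_neg_one (X := X) (by tauto) (by tauto)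
    (mul_left_cancel₀ ha (by rw [h00, h11])) with h | h
  · exact h₁ h
  · exact h₂ h

lemma coe_of_eq_or_eq_neg {X : SL(2, F)} (h : X = 1 ∨ X = -1) :
    ∃ c : F, X.1 = c • (1 : Matrix (Fin 2) (Fin 2) F) := by
  rcases h with rfl | rfl
  · exact ⟨1, by simp⟩
  · exact ⟨-1, by simp⟩

lemma tr_sq_of_cube {X : SL(2, F)} (h₁ : X ≠ 1) (h₂ : X ≠ -1) (h : X ^ 3 = 1 ∨ X ^ 3 = -1) :
    tr X ^ 2 = 1 := by
  obtain ⟨c, hc⟩ := coe_of_eq_or_eq_neg h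
  have : (tr X ^ 2 - 1) • X.1 = (c + tr X) • (1 : Matrix (Fin 2) (Fin 2) F) := by
    have h3 : X.1 ^ 3 = (tr X ^ 2 - 1) • X.1 - tr X • 1 := by
      rw [show X.1 ^ 3 = (X.1 * X.1) * X.1 by noncomm_ring, coe_mul_self, sub_mul, smul_mul_assoc,
        coe_mul_self, one_mul]
      module
    rw [Matrix.SpecialLinearGroup.coe_pow, h3] at hc
    rw [add_smul, ← hc]
    module
  linear_combination eq_zero_of_smul_eq_scalar h₁ h₂ this

lemma tr_of_fifth_power {X : SL(2, F)} (h₁ : X ≠ 1) (h₂ : X ≠ -1) (h : X ^ 5 = 1 ∨ X ^ 5 = -1) :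
    tr X ^ 4 - 3 * tr X ^ 2 + 1 = 0 := by
  obtain ⟨c, hc⟩ := coe_of_eq_or_eq_neg h
  have : (tr X ^ 4 - 3 * tr X ^ 2 + 1) • X.1 =
      (c + tr X ^ 3 - 2 * tr X) • (1 : Matrix (Fin 2) (Fin 2) F) := by
    have h5 : X.1 ^ 5 = (tr X ^ 4 - 3 * tr X ^ 2 + 1) • X.1 - (tr X ^ 3 - 2 * tr X) • 1 := by
      rw [show X.1 ^ 5 = (X.1 * X.1) * (X.1 * X.1) * X.1 by noncomm_ring]
      simp only [coe_mul_self, sub_mul, mul_sub, smul_mul_assoc, mul_smul_comm, one_mul, mul_one]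
      module
    rw [Matrix.SpecialLinearGroup.coe_pow, h5] at hc
    rw [show c + tr X ^ 3 - 2 * tr X = c + (tr X ^ 3 - 2 * tr X) by ring, add_smul c, ← hc]
    module
  exact eq_zero_of_smul_eq_scalar h₁ h₂ this

end Powers

section Moebius

open OnePoint

variable {p : ℕ} [Fact p.Prime]

/-- The action of `SL(2, ZMod p)` on the projective line over the field with `p ^ 2` elements. -/
noncomputable def toGLExt : SL(2, ZMod p) →* GL (Fin 2) (GaloisField p 2) :=
  Matrix.SpecialLinearGroup.toGL.comp
    (Matrix.SpecialLinearGroup.map (algebraMap (ZMod p) (GaloisField p 2)))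

lemma toGLExt_apply (X : SL(2, ZMod p)) (i j : Fin 2) :
    toGLExt X i j = algebraMap (ZMod p) (GaloisField p 2) (X i j) := rfl

noncomputable instance : DecidableEq (GaloisField p 2) := Classical.decEq _

lemma toGLExt_smul_infty {X : SL(2, ZMod p)} :
    toGLExt X • (∞ : OnePoint (GaloisField p 2)) = ∞ ↔ X 1 0 = 0 := by
  rw [smul_infty_eq_self_iff, toGLExt_apply, map_eq_zero]

lemma toGLExt_smul_coe {X : SL(2, ZMod p)} {k : GaloisField p 2} :
    toGLExt X • (k : OnePoint (GaloisField p 2)) = k ↔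
      algebraMap (ZMod p) (GaloisField p 2) (X 1 0) * k ^ 2 +
      (algebraMap (ZMod p) (GaloisField p 2) (X 1 1) -
        algebraMap (ZMod p) (GaloisField p 2) (X 0 0)) * k -
      algebraMap (ZMod p) (GaloisField p 2) (X 0 1) = 0 := by
  rw [← Matrix.GeneralLinearGroup.fixpointPolynomial_aeval_eq_zero_iff]
  simp [Matrix.GeneralLinearGroup.fixpointPolynomial, toGLExt_apply]

lemma isSquare_algebraMap (hp : p ≠ 2) (a : ZMod p) :
    IsSquare (algebraMap (ZMod p) (GaloisField p 2) a) := by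
  have := Fintype.ofFinite (GaloisField p 2)
  by_cases ha : a = 0
  · simp [ha]
  have hodd : Odd p := (Fact.out : p.Prime).odd_of_ne_two hp
  rw [FiniteField.isSquare_iff (by rwa [ringChar.eq (GaloisField p 2) p]) (by simpa using ha),
    ← Nat.card_eq_fintype_card, GaloisField.card p 2 two_ne_zero]
  obtain ⟨k, hk⟩ := hodd
  have : p ^ 2 / 2 = (p - 1) * (k + 1) := by
    rw [show p - 1 = 2 * k by omega, hk]
    rw [show (2 * k + 1) ^ 2 = 1 + 2 * (2 * k * (k + 1)) by ring, Nat.add_mul_div_left _ _ two_pos]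
    omega
  rw [this, pow_mul, ← map_pow, ZMod.pow_card_sub_one_eq_one ha, map_one, one_pow]

lemma ncard_fixed (hp : p ≠ 2) {X : SL(2, ZMod p)} (hX : tr X ^ 2 ≠ 4) :
    {x : OnePoint (GaloisField p 2) | toGLExt X • x = x}.ncard = 2 := by
  have h2 : (2 : GaloisField p 2) ≠ 0 := by
    have := Ring.two_ne_zero (R := GaloisField p 2) (by rwa [ringChar.eq (GaloisField p 2) p])
    exact this
  set f := algebraMap (ZMod p) (GaloisField p 2) with hf
  have hd := congr_arg f (det_eq X)
  simp only [map_sub, map_mul, map_one] at hd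
  have htr : (f (X 0 0) + f (X 1 1)) ^ 2 ≠ 4 := by
    intro h
    apply hX
    apply f.injective
    rw [map_pow, tr, map_add, h, map_ofNat]
  rw [Set.ncard_eq_two]
  by_cases hc : X 1 0 = 0
  · have hne : f (X 0 0) - f (X 1 1) ≠ 0 := by
      rw [hc] at hd
      simp only [map_zero] at hd
      intro h
      apply htr
      linear_combination (f (X 0 0) - f (X 1 1)) * h + 4 * hd
    refine ⟨∞, ((f (X 0 1) / (f (X 1 1) - f (X 0 0)) : GaloisField p 2)), by simp, ?_⟩
    ext x
    cases x with
    | infty => simp [toGLExt_smul_infty, hc]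
    | coe k =>
      have : f (X 1 1) - f (X 0 0) ≠ 0 := by intro h; apply hne; linear_combination -h
      simp only [Set.mem_ofPred_eq, toGLExt_smul_coe, hc, map_zero, ← hf, Set.mem_insert_iff,
        coe_ne_infty, false_or, Set.mem_singleton_iff, coe_eq_coe]
      rw [eq_div_iff this]
      constructor <;> intro h <;> linear_combination h
  · have hc' : f (X 1 0) ≠ 0 := by simpa using hc
    obtain ⟨s, hs⟩ := isSquare_algebraMap hp (tr X ^ 2 - 4)
    rw [← hf] at hs
    simp only [tr, map_sub, map_pow, map_add] at hs
    rw [map_ofNat] at hs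
    have hs0 : s ≠ 0 := by
      rintro rfl
      apply htr
      linear_combination hs
    refine ⟨((f (X 0 0) - f (X 1 1) + s) / (2 * f (X 1 0)) : GaloisField p 2),
      ((f (X 0 0) - f (X 1 1) - s) / (2 * f (X 1 0)) : GaloisField p 2), ?_, ?_⟩
    · rw [Ne, coe_eq_coe, div_left_inj' (mul_ne_zero h2 hc')]
      intro h
      exact mul_ne_zero h2 hs0 (by linear_combination h)
    · ext x
      cases x with
      | infty => simp [toGLExt_smul_infty, hc]
      | coe k =>
        simp only [Set.mem_ofPred_eq, toGLExt_smul_coe, ← hf, Set.mem_insert_iff,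
          Set.mem_singleton_iff, coe_eq_coe]
        rw [eq_div_iff (mul_ne_zero h2 hc'), eq_div_iff (mul_ne_zero h2 hc')]
        constructor
        · intro h
          have : (k * (2 * f (X 1 0)) - (f (X 0 0) - f (X 1 1) + s)) *
              (k * (2 * f (X 1 0)) - (f (X 0 0) - f (X 1 1) - s)) = 0 := by
            linear_combination 4 * f (X 1 0) * h + hs - 4 * hd
          rcases mul_eq_zero.mp this with h | h
          · left; linear_combination h
          · right; linear_combination h
        · intro h
          have h4 : (4 * f (X 1 0)) ≠ 0 := by
            rw [show (4 : GaloisField p 2) = 2 * 2 by norm_num]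
            exact mul_ne_zero (mul_ne_zero h2 h2) hc'
          apply mul_left_cancel₀ h4
          rcases h with h | h
          · linear_combination (k * (2 * f (X 1 0)) - (f (X 0 0) - f (X 1 1) - s)) * h - hs + 4 * hd
          · linear_combination (k * (2 * f (X 1 0)) - (f (X 0 0) - f (X 1 1) + s)) * h - hs + 4 * hd

lemma comDet_of_common_fixed {X Y : SL(2, ZMod p)} {x : OnePoint (GaloisField p 2)}
    (hX : toGLExt X • x = x) (hY : toGLExt Y • x = x) : comDet X Y = 0 := by
  cases x with
  | infty =>
    rw [toGLExt_smul_infty] at hX hY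
    rw [comDet_eq, hX, hY]
    ring
  | coe k =>
    rw [toGLExt_smul_coe] at hX hY
    apply (algebraMap (ZMod p) (GaloisField p 2)).injective
    rw [comDet_eq]
    simp only [map_sub, map_mul, map_neg, map_pow, map_zero]
    rw [sub_eq_zero] at hX hY
    rw [← hX, ← hY]
    ring

end Moebius

section Classification

variable {p : ℕ} [Fact p.Prime]

lemma two_ne_zero_of_ne (hp : p ≠ 2) : (2 : ZMod p) ≠ 0 :=
  Ring.two_ne_zero (by rwa [ringChar.eq (ZMod p) p])

/-- In a subgroup whose only elements of trace `±2` are `±1`, vanishing of `comDet` means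
commuting. -/
lemma commute_of_comDet (hp : p ≠ 2) {H : Subgroup SL(2, ZMod p)}
    (hH : ∀ X ∈ H, tr X ^ 2 = 4 → X = 1 ∨ X = -1) {X Y : SL(2, ZMod p)} (hX : X ∈ H) (hY : Y ∈ H)
    (h : comDet X Y = 0) : X * Y = Y * X := by
  have ht := tr_commutator X Y
  rw [h, sub_zero] at ht
  have hm : X * Y * X⁻¹ * Y⁻¹ ∈ H :=
    H.mul_mem (H.mul_mem (H.mul_mem hX hY) (H.inv_mem hX)) (H.inv_mem hY)
  rcases hH _ hm (by rw [ht]; norm_num) with h1 | h1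
  · rwa [mul_inv_eq_one, mul_inv_eq_iff_eq_mul] at h1
  · exfalso
    have h2 := two_ne_zero_of_ne hp
    rw [h1] at ht
    rw [tr_neg, tr, one_00, one_11] at ht
    exact mul_ne_zero h2 h2 (by linear_combination -ht)

/-- The subgroups of `SL(2, ZMod p)` without nontrivial unipotent elements, in terms of traces. -/
theorem trace_classification (hp : p ≠ 2) {H : Subgroup SL(2, ZMod p)} (hneg : -1 ∈ H)
    (hH : ∀ X ∈ H, tr X ^ 2 = 4 → X = 1 ∨ X = -1) {X Y : SL(2, ZMod p)} (hX : X ∈ H)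
    (hY : Y ∈ H) :
    comDet X Y = 0 ∨ ((tr X = 0 ∧ tr Y = 0) ∨ (tr X = 0 ∧ tr (X * Y) = 0) ∨
      (tr Y = 0 ∧ tr (X * Y) = 0)) ∨
    (∀ Z ∈ H, Z ≠ 1 → Z ≠ -1 → tr Z = 0 ∨ tr Z ^ 2 = 1) ∨
    IsSquare (2 : ZMod p) ∨ IsSquare (5 : ZMod p) := by
  by_cases hcd : comDet X Y = 0
  · exact Or.inl hcd
  right
  have h2 := two_ne_zero_of_ne hp
  have : Finite (OnePoint (GaloisField p 2)) := inferInstanceAs (Finite (Option _))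
  let _ : MulAction H (OnePoint (GaloisField p 2)) :=
    MulAction.compHom _ (toGLExt.comp H.subtype)
  have smul_def (g : H) (x : OnePoint (GaloisField p 2)) : g • x = toGLExt g.1 • x := rfl
  have hcomm {g h : H} {x : OnePoint (GaloisField p 2)} (hg : g • x = x) (hh : h • x = x) :
      g * h = h * g :=
    Subtype.ext (commute_of_comDet hp hH g.2 h.2 (comDet_of_common_fixed hg hh))
  set z : H := ⟨-1, hneg⟩ with hz
  have hz1 : z ≠ 1 := fun h ↦ neg_one_ne_one h2 (congr_arg Subtype.val h)
  have hz2 : z * z = 1 := Subtype.ext (by simp [hz])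
  have hne {g : H} (h1 : g ≠ 1) (hgz : g ≠ z) : g.1 ≠ 1 ∧ g.1 ≠ -1 :=
    ⟨fun h ↦ h1 (Subtype.ext h), fun h ↦ hgz (Subtype.ext h)⟩
  have hzfix (x : OnePoint (GaloisField p 2)) : z • x = x := by
    rw [smul_def]
    cases x with
    | infty => rw [toGLExt_smul_infty]; simp [hz]
    | coe k => rw [toGLExt_smul_coe]; simp [hz]
  have hfix (g : H) (h1 : g ≠ 1) (hgz : g ≠ z) :
      (MulAction.fixedBy (OnePoint (GaloisField p 2)) g).ncard = 2 := by
    have := hne h1 hgz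
    exact ncard_fixed hp fun h ↦ by have := hH g.1 g.2 h; tauto
  have hstab (x : OnePoint (GaloisField p 2)) : MulAction.stabilizer H x ≠ ⊤ := by
    intro h
    apply hcd
    have hx (g : H) : g • x = x := by
      rw [← MulAction.mem_stabilizer_iff, h]; exact Subgroup.mem_top _
    exact comDet_of_common_fixed (x := x) (hx ⟨X, hX⟩) (hx ⟨Y, hY⟩)
  have hX1 : X ≠ 1 := by rintro rfl; exact hcd (comDet_of_commute (by simp))
  have hX2 : X ≠ -1 := by rintro rfl; exact hcd (comDet_of_commute (by simp))
  have hz' : (z : SL(2, ZMod p)) = -1 := rfl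
  have hmem (S : Subgroup H) (T : Finset H) (hT : T.card < Nat.card S) : ∃ g ∈ S, g ∉ T := by
    by_contra! h
    have := Set.ncard_le_ncard (s := (S : Set H)) (t := T) (fun g hg ↦ by simpa using h g hg)
    rw [Set.ncard_coe_finset] at this
    exact absurd this (not_le.mpr hT)
  have hcard : 2 < Nat.card H := by
    by_contra! hle
    classical
    have := Set.ncard_le_ncard (s := (({1, z, ⟨X, hX⟩} : Finset H) : Set H))
      (t := Set.univ) (Set.subset_univ _) Set.finite_univ
    rw [Set.ncard_coe_finset, Set.ncard_univ, Finset.card_eq_three.mpr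
      ⟨1, z, ⟨X, hX⟩, hz1.symm, fun h ↦ hX1 (congr_arg Subtype.val h).symm,
        fun h ↦ hX2 (congr_arg Subtype.val h).symm, rfl⟩] at this
    omega
  have hpow {S : Subgroup H} {g : H} (hg : g ∈ S) : g.1 ^ Nat.card S = 1 := by
    have := pow_card_eq_one' (x := (⟨g, hg⟩ : S))
    exact congr_arg (fun s : S ↦ s.1.1) this
  have hsq {Z : SL(2, ZMod p)} {n : ℕ} (h : Z ^ (n * 2) = 1) : Z ^ n = 1 ∨ Z ^ n = -1 :=
    eq_of_sq_eq_one h2 (by rw [← pow_two, ← pow_mul, h])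
  rcases stabilizer_orders z hz1 hz2 hzfix hfix hcard hstab with ⟨x, hx⟩ | hx | ⟨x, hx⟩ | ⟨x, hx⟩
  · left
    set S := MulAction.stabilizer H x with hS
    have hindex : S.index = 2 := by
      have := S.card_mul_index
      rw [← hx, mul_comm 2] at this
      exact Nat.eq_of_mul_eq_mul_left Nat.card_pos this
    have hzS : z ∈ S := hzfix x
    have htr (U : H) (hU : U ∉ S) : tr U.1 = 0 := by
      have hU2 : U * U ∈ S := Subgroup.mul_self_mem_of_index_two hindex U
      by_cases h1 : U * U = 1
      · rcases eq_of_sq_eq_one h2 (congr_arg Subtype.val h1) with h | h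
        · exact absurd (show U ∈ S from (Subtype.ext h : U = 1) ▸ S.one_mem) hU
        · exact absurd (show U ∈ S from (Subtype.ext h : U = z) ▸ hzS) hU
      by_cases h3 : U * U = z
      · exact tr_zero_of_sq (congr_arg Subtype.val h3)
      exfalso
      have hU1 : U ≠ 1 := by rintro rfl; exact hU S.one_mem
      have hUz : U ≠ z := by rintro rfl; exact hU hzS
      have hsub : MulAction.fixedBy (OnePoint (GaloisField p 2)) U ⊆
          MulAction.fixedBy (OnePoint (GaloisField p 2)) (U * U) := by
        intro y hy
        rw [MulAction.mem_fixedBy] at hy ⊢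
        rw [mul_smul, hy, hy]
      have := Set.eq_of_subset_of_ncard_le hsub (by rw [hfix _ h1 h3, hfix _ hU1 hUz])
      have hxU : x ∈ MulAction.fixedBy (OnePoint (GaloisField p 2)) U := this ▸ hU2
      exact hU hxU
    by_cases hXS : (⟨X, hX⟩ : H) ∈ S <;> by_cases hYS : (⟨Y, hY⟩ : H) ∈ S
    · exact absurd (comDet_of_common_fixed (x := x) hXS hYS) hcd
    · refine Or.inr (Or.inr ⟨htr _ hYS, htr (⟨X, hX⟩ * ⟨Y, hY⟩) ?_⟩)
      rwa [S.mul_mem_cancel_left hXS]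
    · refine Or.inr (Or.inl ⟨htr _ hXS, htr (⟨X, hX⟩ * ⟨Y, hY⟩) ?_⟩)
      rwa [S.mul_mem_cancel_right hYS]
    · exact Or.inl ⟨htr _ hXS, htr _ hYS⟩
  · right; left
    intro Z hZ hZ1 hZ2
    obtain ⟨x, hxZ⟩ : (MulAction.fixedBy (OnePoint (GaloisField p 2)) (⟨Z, hZ⟩ : H)).Nonempty := by
      apply Set.nonempty_of_ncard_ne_zero
      rw [hfix _ (fun h ↦ hZ1 (congr_arg Subtype.val h)) (fun h ↦ hZ2 (congr_arg Subtype.val h))]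
      exact two_ne_zero
    set S := MulAction.stabilizer H x with hS
    have hpw := hpow (S := S) hxZ
    have h6 : Nat.card S ≤ 6 := hx x
    have hpos : 0 < Nat.card S := Nat.card_pos
    have heven : 2 ∣ Nat.card S := by
      have : orderOf (⟨z, hzfix x⟩ : S) = 2 :=
        orderOf_eq_prime (Subtype.ext (by rw [pow_two]; exact hz2))
          (fun h ↦ hz1 (congr_arg Subtype.val h))
      exact this.symm.dvd.trans (orderOf_dvd_natCard _)
    generalize Nat.card S = n at hpw h6 hpos heven
    obtain rfl | rfl | rfl : n = 2 ∨ n = 4 ∨ n = 6 := by omega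
    · have := hsq (n := 1) hpw
      rw [pow_one] at this
      tauto
    · rcases hsq (n := 2) hpw with h | h
      · have := eq_of_sq_eq_one h2 (by rwa [← pow_two])
        tauto
      · left
        exact tr_zero_of_sq (by rwa [← pow_two])
    · right
      exact tr_sq_of_cube hZ1 hZ2 (hsq (n := 3) hpw)
  · right; right; left
    set S := MulAction.stabilizer H x with hS
    classical
    obtain ⟨W, hWS, hW1, hW2⟩ : ∃ W ∈ S, W.1 ^ 2 ≠ 1 ∧ W.1 ^ 2 ≠ -1 := by
      obtain ⟨Z, hZS, hZ⟩ := hmem S {1, z} (lt_of_le_of_lt Finset.card_le_two (by rw [hx]; simp))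
      simp only [Finset.mem_insert, Finset.mem_singleton, not_or] at hZ
      obtain ⟨hZ1, hZ2⟩ := hne hZ.1 hZ.2
      by_cases hZsq : Z.1 ^ 2 = -1
      · obtain ⟨W, hWS, hW⟩ := hmem S {1, z, Z, z * Z}
          (lt_of_le_of_lt Finset.card_le_four (by rw [hx]; simp))
        simp only [Finset.mem_insert, Finset.mem_singleton, not_or] at hW
        obtain ⟨hW1, hW2⟩ := hne hW.1 hW.2.1
        refine ⟨W, hWS, fun h ↦ ?_, fun h ↦ ?_⟩
        · have := eq_of_sq_eq_one h2 (by rwa [← pow_two])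
          tauto
        · have hc : W.1 * Z.1 = Z.1 * W.1 := congr_arg Subtype.val (hcomm (x := x) hWS hZS)
          have : (W.1 * Z.1) * (W.1 * Z.1) = 1 := by
            calc _ = W.1 * (Z.1 * W.1) * Z.1 := by simp only [mul_assoc]
              _ = W.1 ^ 2 * Z.1 ^ 2 := by rw [← hc]; simp only [pow_two, mul_assoc]
              _ = 1 := by rw [h, hZsq]; simp
          have hinv : Z.1⁻¹ = -Z.1 := by
            rw [inv_eq_iff_mul_eq_one, mul_neg, ← pow_two, hZsq, neg_neg]
          rcases eq_of_sq_eq_one h2 this with h | h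
          · apply hW.2.2.2
            apply Subtype.ext
            rw [mul_eq_one_iff_eq_inv, hinv] at h
            rw [h]; simp [hz]
          · apply hW.2.2.1
            apply Subtype.ext
            rw [← eq_mul_inv_iff_mul_eq, hinv] at h
            rw [h]; simp
      · refine ⟨Z, hZS, fun h ↦ ?_, hZsq⟩
        have := eq_of_sq_eq_one h2 (by rwa [← pow_two])
        tauto
    have h8 := hpow hWS
    rw [hx] at h8
    rcases hsq (n := 4) h8 with h | h
    · have := hsq (n := 2) h
      tauto
    · have h0 := tr_zero_of_sq (X := W.1 * W.1) (by rw [← h]; simp only [pow_succ, pow_zero, one_mul, mul_assoc])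
      rw [tr_sq] at h0
      exact ⟨tr W.1, by linear_combination -h0⟩
  · right; right; right
    classical
    obtain ⟨Z, hZS, hZ⟩ := hmem (MulAction.stabilizer H x) {1, z}
      (lt_of_le_of_lt Finset.card_le_two (by rw [hx]; simp))
    simp only [Finset.mem_insert, Finset.mem_singleton, not_or] at hZ
    obtain ⟨hZ1, hZ2⟩ := hne hZ.1 hZ.2
    have h10 := hpow hZS
    rw [hx] at h10
    have := tr_of_fifth_power hZ1 hZ2 (hsq (n := 5) h10)
    exact ⟨2 * tr Z.1 ^ 2 - 3, by linear_combination -4 * this⟩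

/-- The relation between two elements of `SL(2, F)` satisfied by all pairs in a proper subgroup
of `SL(2, ZMod p)` when neither `2` nor `5` is a square. -/
def TraceRel {F : Type*} [Field F] (X Y : SL(2, F)) : Prop :=
  comDet X Y = 0 ∨ ((tr X = 0 ∧ tr Y = 0) ∨ (tr X = 0 ∧ tr (X * Y) = 0) ∨
      (tr Y = 0 ∧ tr (X * Y) = 0)) ∨
    ((tr X = 0 ∨ tr X ^ 2 = 1) ∧ (tr Y = 0 ∨ tr Y ^ 2 = 1) ∧
      (tr (X * Y) = 0 ∨ tr (X * Y) ^ 2 = 1) ∧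
      (tr X * tr Y - tr (X * Y) = 0 ∨ (tr X * tr Y - tr (X * Y)) ^ 2 = 1))

theorem traceRel_of_mem (hp : p ≠ 2) (hs2 : ¬ IsSquare (2 : ZMod p))
    (hs5 : ¬ IsSquare (5 : ZMod p)) {H : Subgroup SL(2, ZMod p)} (hneg : -1 ∈ H) (hH : H ≠ ⊤)
    {X Y : SL(2, ZMod p)} (hX : X ∈ H) (hY : Y ∈ H) : TraceRel X Y := by
  by_cases hu : ∀ X ∈ H, tr X ^ 2 = 4 → X = 1 ∨ X = -1
  · rcases trace_classification hp hneg hu hX hY with h | h | h | h | h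
    · exact Or.inl h
    · exact Or.inr (Or.inl h)
    · by_cases hcd : comDet X Y = 0
      · exact Or.inl hcd
      refine Or.inr (Or.inr ?_)
      have hX1 : X ≠ 1 := by rintro rfl; exact hcd (comDet_of_commute (by simp))
      have hX2 : X ≠ -1 := by rintro rfl; exact hcd (comDet_of_commute (by simp))
      have hY1 : Y ≠ 1 := by rintro rfl; exact hcd (comDet_of_commute (by simp))
      have hY2 : Y ≠ -1 := by rintro rfl; exact hcd (comDet_of_commute (by simp))
      refine ⟨h X hX hX1 hX2, h Y hY hY1 hY2, h _ (H.mul_mem hX hY) ?_ ?_, ?_⟩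
      · intro hXY
        rw [mul_eq_one_iff_inv_eq] at hXY
        subst hXY
        exact hcd (comDet_of_commute (by simp))
      · intro hXY
        rw [← eq_inv_mul_iff_mul_eq] at hXY
        subst hXY
        exact hcd (comDet_of_commute (by simp))
      · rw [← tr_inv_mul]
        refine h _ (H.mul_mem (H.inv_mem hX) hY) ?_ ?_
        · intro hXY
          rw [inv_mul_eq_one] at hXY
          subst hXY
          exact hcd (comDet_of_commute rfl)
        · intro hXY
          rw [inv_mul_eq_iff_eq_mul] at hXY
          subst hXY
          exact hcd (comDet_of_commute (by simp))
    · exact absurd h hs2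
    · exact absurd h hs5
  · left
    push Not at hu
    obtain ⟨U, hU, htU, hU1, hU2⟩ := hu
    obtain ⟨V, hV, htV, hV1, hV2⟩ : ∃ V ∈ H, tr V = 2 ∧ V ≠ 1 ∧ V ≠ -1 := by
      have : (tr U - 2) * (tr U + 2) = 0 := by linear_combination htU
      rcases mul_eq_zero.mp this with h | h
      · exact ⟨U, hU, by linear_combination h, hU1, hU2⟩
      · refine ⟨-U, ?_, by rw [tr_neg]; linear_combination -h, fun h ↦ hU2 ?_, fun h ↦ hU1 ?_⟩
        · simpa using H.mul_mem hneg hU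
        · rw [← h, neg_neg]
        · simpa using h
    obtain ⟨P, hP⟩ := exists_conj_upper (X := V) (l := 1) (by rw [htV]; ring)
    set V' := P⁻¹ * V * P with hV'
    have htV' : tr V' = 2 := by rw [hV', tr_conj, htV]
    have hd := det_eq V'
    have h00 : V' 0 0 = 1 := by
      rw [tr] at htV'
      rw [hP] at hd
      have : (V' 0 0 - 1) ^ 2 = 0 := by
        linear_combination V' 0 0 * htV' - hd
      have := pow_eq_zero_iff (two_ne_zero) |>.mp this
      linear_combination this
    have h11 : V' 1 1 = 1 := by rw [tr] at htV'; linear_combination htV' - h00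
    have hV'u : V' = upper (V' 0 1) := by
      apply sl_ext <;> simp [upper, h00, h11, hP]
    have hVu : P * upper (V' 0 1) * P⁻¹ = V := by
      rw [← hV'u, hV']; group
    have hs : V' 0 1 ≠ 0 := by
      intro h0
      apply hV1
      have : upper (0 : ZMod p) = 1 := by apply sl_ext <;> simp [upper]
      rw [← hVu, h0, this]; group
    have hle (Z : SL(2, ZMod p)) (hZ : Z ∈ H) : Z ∈ borel P := by
      by_contra hc
      exact hH (eq_top_of_conj_upper_mem hs (hVu ▸ hV) hZ hc)
    have hXb := mem_borel.mp (hle X hX)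
    have hYb := mem_borel.mp (hle Y hY)
    rw [← comDet_conj P, comDet_eq, hXb, hYb]
    ring

end Classification

/-! ### Maximal subgroups isomorphic to the alternating group -/

section Alternating

/-- The double transposition `(0 1)(2 3)`. -/
def doubleTransposition : alternatingGroup (Fin 4) :=
  ⟨Equiv.swap 0 1 * Equiv.swap 2 3, Equiv.Perm.mem_alternatingGroup.mpr (by decide)⟩

/-- The three-cycle `(0 1)(1 2)`. -/
def threeCycle : alternatingGroup (Fin 4) :=
  ⟨Equiv.swap 0 1 * Equiv.swap 1 2, Equiv.Perm.mem_alternatingGroup.mpr (by decide)⟩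

lemma alternating_cases (g : alternatingGroup (Fin 4)) :
    (∃ a : Fin 3, g = threeCycle ^ a.1) ∨
      ∃ a b : Fin 3, g = threeCycle ^ a.1 * doubleTransposition * threeCycle ^ b.1 := by
  revert g
  decide +kernel

lemma alternating_not_inverting (g : alternatingGroup (Fin 4)) :
    g * g = 1 → g * threeCycle * (g * threeCycle) ≠ 1 := by
  revert g
  decide +kernel

/-- A group with a maximal subgroup isomorphic to `A₄` is small as soon as it contains an
involution inverting a three-cycle and suitably related to a double transposition. -/
lemma card_le_of_isCoatom_alternating {G : Type*} [Group G] {M : Subgroup G} (hM : IsCoatom M)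
    (e : alternatingGroup (Fin 4) ≃* M) {s : G} (hs : s * s = 1)
    (hsw : s * (e threeCycle).1 * (s * (e threeCycle).1) = 1)
    (hsi : s * (e doubleTransposition).1 * s = (e doubleTransposition).1 ∨
      s * (e doubleTransposition).1 * s = (e doubleTransposition).1 * s *
        (e doubleTransposition).1) :
    Nat.card G ≤ 156 := by
  set w := (e threeCycle).1 with hw
  set i := (e doubleTransposition).1 with hi
  have hsM : s ∉ M := by
    intro h
    apply alternating_not_inverting (e.symm ⟨s, h⟩)
    · rw [← map_mul, ← map_one e.symm]
      exact congr_arg e.symm (Subtype.ext hs)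
    · apply e.injective
      simp only [map_mul, MulEquiv.apply_symm_apply, map_one]
      exact Subtype.ext hsw
  have hcases (m : G) (hm : m ∈ M) : (∃ a : ℕ, m = w ^ a) ∨ ∃ a b : ℕ, m = w ^ a * i * w ^ b := by
    rcases alternating_cases (e.symm ⟨m, hm⟩) with ⟨a, h⟩ | ⟨a, b, h⟩
    · left
      refine ⟨a, ?_⟩
      rw [MulEquiv.symm_apply_eq] at h
      simpa using congr_arg Subtype.val h
    · right
      refine ⟨a, b, ?_⟩
      rw [MulEquiv.symm_apply_eq] at h
      simpa using congr_arg Subtype.val h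
  have hsinv : s⁻¹ = s := inv_eq_of_mul_eq_one_left hs
  have hsw' (a : ℕ) : s * w ^ a = w⁻¹ ^ a * s := by
    have : SemiconjBy s w w⁻¹ := by
      rw [SemiconjBy, eq_inv_of_mul_eq_one_left hsw, mul_inv_rev, hsinv]
    exact this.pow_right a
  have hwM : w ∈ M := (e threeCycle).2
  have hiM : i ∈ M := (e doubleTransposition).2
  have htop : Subgroup.closure ((M : Set G) ∪ {s}) = ⊤ := by
    apply hM.2
    rw [SetLike.lt_iff_le_and_exists]
    exact ⟨fun m hm ↦ Subgroup.subset_closure (Or.inl hm), s,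
      Subgroup.subset_closure (Or.inr rfl), hsM⟩
  have hwM' (a : ℕ) : w⁻¹ ^ a ∈ M := M.pow_mem (M.inv_mem hwM) a
  have hright {x : G} (hx : x ∈ M ∨ ∃ m ∈ M, ∃ m' ∈ M, x = m * s * m') :
      x * s ∈ M ∨ ∃ m ∈ M, ∃ m' ∈ M, x * s = m * s * m' := by
    rcases hx with hx | ⟨m, hm, m', hm', rfl⟩
    · exact Or.inr ⟨x, hx, 1, M.one_mem, by simp⟩
    · rcases hcases m' hm' with ⟨a, rfl⟩ | ⟨a, b, rfl⟩
      · left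
        rw [mul_assoc m, hsw', mul_assoc, mul_assoc, hs, mul_one]
        exact M.mul_mem hm (hwM' a)
      · have hb : w ^ b * s = s * w⁻¹ ^ b := by
          calc _ = s * (s * w ^ b) * s := by rw [← mul_assoc, hs, one_mul]
            _ = _ := by rw [hsw', mul_assoc, mul_assoc, hs, mul_one]
        have : m * s * (w ^ a * i * w ^ b) * s = m * w⁻¹ ^ a * (s * i * s) * w⁻¹ ^ b := by
          calc _ = m * (s * w ^ a) * i * (w ^ b * s) := by simp only [mul_assoc]
            _ = _ := by rw [hsw', hb]; simp only [mul_assoc]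
        rw [this]
        rcases hsi with h | h
        · left
          rw [h]
          exact M.mul_mem (M.mul_mem (M.mul_mem hm (hwM' a)) hiM) (hwM' b)
        · right
          refine ⟨m * w⁻¹ ^ a * i, M.mul_mem (M.mul_mem hm (hwM' a)) hiM, i * w⁻¹ ^ b,
            M.mul_mem hiM (hwM' b), ?_⟩
          rw [h]; simp only [mul_assoc]
  have hall (g : G) : g ∈ M ∨ ∃ m ∈ M, ∃ m' ∈ M, g = m * s * m' := by
    have hg : g ∈ Subgroup.closure ((M : Set G) ∪ {s}) := htop ▸ Subgroup.mem_top g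
    have hMr {x y : G} (hy : y ∈ M) (hx : x ∈ M ∨ ∃ m ∈ M, ∃ m' ∈ M, x = m * s * m') :
        x * y ∈ M ∨ ∃ m ∈ M, ∃ m' ∈ M, x * y = m * s * m' := by
      rcases hx with hx | ⟨m, hm, m', hm', rfl⟩
      · exact Or.inl (M.mul_mem hx hy)
      · exact Or.inr ⟨m, hm, m' * y, M.mul_mem hm' hy, by simp only [mul_assoc]⟩
    induction hg using Subgroup.closure_induction_right with
    | one => exact Or.inl M.one_mem
    | mul_right x _ y hy ih =>
      rcases hy with hy | rfl
      · exact hMr hy ih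
      · exact hright ih
    | mul_inv_cancel x _ y hy ih =>
      rcases hy with hy | rfl
      · exact hMr (M.inv_mem hy) ih
      · rw [hsinv]; exact hright ih
  have hcardM : Nat.card M = 12 := by
    rw [← Nat.card_congr e.toEquiv, Nat.card_eq_fintype_card]
    decide +kernel
  have : Finite M := Nat.finite_of_card_ne_zero (by rw [hcardM]; simp)
  have hsurj : Function.Surjective (Sum.elim (fun m : M ↦ m.1)
      (fun m : M × M ↦ m.1.1 * s * m.2.1) : M ⊕ M × M → G) := by
    intro g
    rcases hall g with h | ⟨m, hm, m', hm', h⟩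
    · exact ⟨Sum.inl ⟨g, h⟩, rfl⟩
    · exact ⟨Sum.inr (⟨m, hm⟩, ⟨m', hm'⟩), h.symm⟩
  have := Nat.card_le_card_of_surjective _ hsurj
  rwa [Nat.card_sum, Nat.card_prod, hcardM] at this

variable {p : ℕ} [Fact p.Prime]

lemma mk_eq_one {X : SL(2, ZMod p)} :
    QuotientGroup.mk' (Subgroup.center SL(2, ZMod p)) X = 1 ↔ X = 1 ∨ X = -1 := by
  rw [QuotientGroup.mk'_apply, QuotientGroup.eq_one_iff, mem_center]

lemma tr_zero_of_mk_involution (hp : p ≠ 2) {X : SL(2, ZMod p)}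
    (h : QuotientGroup.mk' (Subgroup.center SL(2, ZMod p)) (X * X) = 1)
    (h1 : QuotientGroup.mk' (Subgroup.center SL(2, ZMod p)) X ≠ 1) : tr X = 0 := by
  rw [Ne, mk_eq_one] at h1
  rcases mk_eq_one.mp h with h | h
  · exact absurd (eq_of_sq_eq_one (two_ne_zero_of_ne hp) h) h1
  · exact tr_zero_of_sq h

lemma card_SL_ge : (p - 1) * p * (p + 1) ≤ Nat.card SL(2, ZMod p) := by
  have hp : Nat.card (ZMod p) = p := by simp
  have hu : Nat.card (ZMod p)ˣ = p - 1 := by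
    rw [Nat.card_eq_fintype_card, ZMod.card_units]
  have hinj : Function.Injective (Sum.elim
      (fun t : (ZMod p)ˣ × ZMod p × ZMod p ↦ ofEntries t.2.1 ((t.2.1 * t.2.2 - 1) / t.1) t.1 t.2.2
        (by rw [div_mul_cancel₀ _ t.1.ne_zero]; ring))
      (fun t : (ZMod p)ˣ × ZMod p ↦ ofEntries t.1.1 t.2 0 t.1⁻¹.1 (by rw [Units.mul_inv]; ring))) := by
    rintro (⟨c, a, d⟩ | ⟨a, b⟩) (⟨c', a', d'⟩ | ⟨a', b'⟩) h <;>
      have h00 := congr_arg (fun X : SL(2, ZMod p) ↦ X 0 0) h <;>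
      have h01 := congr_arg (fun X : SL(2, ZMod p) ↦ X 0 1) h <;>
      have h10 := congr_arg (fun X : SL(2, ZMod p) ↦ X 1 0) h <;>
      have h11 := congr_arg (fun X : SL(2, ZMod p) ↦ X 1 1) h <;>
      simp only [Sum.elim_inl, Sum.elim_inr, ofEntries_00, ofEntries_01, ofEntries_10,
        ofEntries_11] at h00 h01 h10 h11
    · rw [h00, h11, Units.ext h10]
    · exact absurd h10 c.ne_zero
    · exact absurd h10.symm c'.ne_zero
    · rw [h01, Units.ext h00]
  have := Nat.card_le_card_of_injective _ hinj
  rw [Nat.card_sum, Nat.card_prod, Nat.card_prod, Nat.card_prod, hp, hu] at this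
  linarith

lemma card_SL_le :
    Nat.card SL(2, ZMod p) ≤ Nat.card PSL(2, ZMod p) * 2 := by
  rw [Subgroup.card_eq_card_quotient_mul_card_subgroup (Subgroup.center SL(2, ZMod p))]
  gcongr
  have : ((Subgroup.center SL(2, ZMod p) : Set SL(2, ZMod p))) ⊆ {1, -1} :=
    fun X hX ↦ mem_center.mp hX
  exact (Set.ncard_le_ncard this).trans ((Set.ncard_insert_le _ _).trans (by simp))

lemma cube_of_tr_sq {F : Type*} [Field F] {X : SL(2, F)} (h : tr X ^ 2 = 1) :
    X * X * X = 1 ∨ X * X * X = -1 := by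
  have h3 : X.1 * X.1 * X.1 = (tr X ^ 2 - 1) • X.1 - tr X • 1 := by
    rw [coe_mul_self, sub_mul, smul_mul_assoc, coe_mul_self, one_mul]
    module
  rw [h, sub_self, zero_smul, zero_sub] at h3
  rcases mul_self_eq_one_iff.mp ((pow_two _).symm.trans h) with h | h
  · right; apply Subtype.ext; simp [h3, h]
  · left; apply Subtype.ext; simp [h3, h]

theorem not_isSquare_of_alternating (hp : 5 < p) {M : Subgroup PSL(2, ZMod p)} (hM : IsCoatom M)
    (e : alternatingGroup (Fin 4) ≃* M) :
    ¬ IsSquare (2 : ZMod p) ∧ ¬ IsSquare (5 : ZMod p) := by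
  have hp2 : p ≠ 2 := by omega
  have h2 := two_ne_zero_of_ne hp2
  set π := QuotientGroup.mk' (Subgroup.center SL(2, ZMod p)) with hπ
  obtain ⟨I, hI⟩ := QuotientGroup.mk'_surjective _ (e doubleTransposition).1
  obtain ⟨W, hW⟩ := QuotientGroup.mk'_surjective _ (e threeCycle).1
  rw [← hπ] at hI hW
  have htr {X : SL(2, ZMod p)} (g : alternatingGroup (Fin 4)) (hX : π X = (e g).1)
      (hg : g * g = 1) (hg1 : g ≠ 1) : tr X = 0 := by
    apply tr_zero_of_mk_involution hp2
    · rw [← hπ, map_mul, hX, ← Subgroup.coe_mul, ← map_mul, hg, map_one, Subgroup.coe_one]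
    · rw [← hπ, hX]
      intro h
      apply hg1
      apply e.injective
      rw [map_one]
      exact Subtype.ext h
  set i := doubleTransposition with hi
  set w := threeCycle with hw
  set j := w * i * w⁻¹ with hj
  set k := w * j * w⁻¹ with hk
  set J := W * I * W⁻¹ with hJ
  set K := W * J * W⁻¹ with hK
  have hπJ : π J = (e j).1 := by simp [hJ, hj, hI, hW]
  have hπK : π K = (e k).1 := by simp [hK, hk, hπJ, hW]
  have hI0 : tr I = 0 := htr i hI (by decide +kernel) (by decide +kernel)
  have hJ0 : tr J = 0 := htr j hπJ (by decide +kernel) (by decide +kernel)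
  have hK0 : tr K = 0 := htr k hπK (by decide +kernel) (by decide +kernel)
  have hIJ : tr (I * J) = 0 :=
    htr (i * j) (by simp [hI, hπJ]) (by decide +kernel) (by decide +kernel)
  have hIK : tr (I * K) = 0 :=
    htr (i * k) (by simp [hI, hπK]) (by decide +kernel) (by decide +kernel)
  have hJK : tr (J * K) = 0 :=
    htr (j * k) (by simp [hπJ, hπK]) (by decide +kernel) (by decide +kernel)
  have hJW : tr (J * W) = tr (I * W) := by
    rw [hJ, mul_assoc, mul_assoc, inv_mul_cancel, mul_one, tr_mul_comm]
  have hKW : tr (K * W) = tr (I * W) := by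
    rw [hK, mul_assoc, mul_assoc, inv_mul_cancel, mul_one, tr_mul_comm, hJW]
  clear_value J K
  have hcard : 156 < Nat.card PSL(2, ZMod p) := by
    have h := card_SL_ge.trans (card_SL_le (p := p))
    have : 7 ≤ p := by
      have : p ≠ 6 := by rintro rfl; exact absurd (Fact.out : (6).Prime) (by decide)
      omega
    have : 6 * 7 * 8 ≤ (p - 1) * p * (p + 1) := by gcongr <;> omega
    omega
  have key (x y z : ZMod p) (h1 : x ^ 2 + y ^ 2 + z ^ 2 = 1) (h0 : x + y + z = 0)
      (hx : x = 0 ∨ (2 * x) ^ 2 = 1) : False := by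
    have hdI := det_eq I
    have hdJ := det_eq J
    have hdK := det_eq K
    simp only [tr, mul_00, mul_11] at hI0 hJ0 hK0 hIJ hIK hJK hJW hKW
    set S : SL(2, ZMod p) := ofEntries (x * I 0 0 + y * J 0 0 + z * K 0 0)
      (x * I 0 1 + y * J 0 1 + z * K 0 1) (x * I 1 0 + y * J 1 0 + z * K 1 0)
      (x * I 1 1 + y * J 1 1 + z * K 1 1) (by
        linear_combination x ^ 2 * hdI + y ^ 2 * hdJ + z ^ 2 * hdK +
          x * y * ((J 0 0 + J 1 1) * hI0 - hIJ) + x * z * ((K 0 0 + K 1 1) * hI0 - hIK) +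
          y * z * ((K 0 0 + K 1 1) * hJ0 - hJK) + h1) with hS
    have hS0 : tr S = 0 := by
      simp only [tr, hS, ofEntries_00, ofEntries_11]
      linear_combination x * hI0 + y * hJ0 + z * hK0
    have hSW : tr (S * W) = 0 := by
      simp only [tr, hS, mul_00, mul_11, ofEntries_00, ofEntries_11, ofEntries_01, ofEntries_10]
      linear_combination (I 0 0 * W 0 0 + I 0 1 * W 1 0 + I 1 0 * W 0 1 + I 1 1 * W 1 1) * h0 +
        y * hJW + z * hKW
    have hSI : tr (S * I) = - (2 * x) := by
      simp only [tr, hS, mul_00, mul_11, ofEntries_00, ofEntries_11, ofEntries_01, ofEntries_10]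
      linear_combination x * ((I 0 0 + I 1 1) * hI0 - 2 * hdI) + y * hIJ + z * hIK
    have hneg : π (-1) = 1 := mk_eq_one.mpr (Or.inr rfl)
    have hs : π S * π S = 1 := by rw [← map_mul, sq_of_tr_zero hS0, hneg]
    have hii : π I * π I = 1 := by rw [← map_mul, sq_of_tr_zero hI0, hneg]
    have hinv {a : PSL(2, ZMod p)} (h : a * a = 1) : a⁻¹ = a := inv_eq_of_mul_eq_one_left h
    apply hcard.not_ge
    apply card_le_of_isCoatom_alternating hM e hs
    · rw [← hW, ← map_mul, ← map_mul, sq_of_tr_zero hSW, hneg]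
    · rw [← hI]
      rcases hx with hx | hx
      · left
        have h : π S * π I * (π S * π I) = 1 := by
          rw [← map_mul, ← map_mul, sq_of_tr_zero (by rw [hSI, hx]; ring), hneg]
        rw [← mul_assoc, mul_eq_one_iff_eq_inv, hinv hii] at h
        exact h
      · right
        have h : π S * π I * (π S * π I) * (π S * π I) = 1 := by
          rw [← map_mul, ← map_mul, ← map_mul, hπ, mk_eq_one]
          exact cube_of_tr_sq (by rw [hSI]; linear_combination hx)
        have h' : π S * π I * π S * (π I * π S * π I) = 1 := by
          rw [← h]; simp only [mul_assoc]
        rw [mul_eq_one_iff_eq_inv, mul_inv_rev, mul_inv_rev, hinv hii, hinv hs,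
          ← mul_assoc] at h'
        exact h'
  constructor
  · rintro ⟨r, hr⟩
    have hr0 : r ≠ 0 := by rintro rfl; exact h2 (by linear_combination hr)
    apply key 0 (1 / r) (-1 / r) _ (by ring) (Or.inl rfl)
    field_simp
    linear_combination hr
  · rintro ⟨r, hr⟩
    obtain ⟨u, hu⟩ : ∃ u : ZMod p, 2 * u = 1 := ⟨1 / 2, by field_simp⟩
    exact key u (u ^ 2 * (-1 + r)) (u ^ 2 * (-1 - r)) (by grind) (by grind) (Or.inr (by grind))

end Alternating

/-! ### Counting elements related to split ones -/

section Counting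

lemma traceRel_conj {F : Type*} [Field F] (P : SL(2, F)) {X Y : SL(2, F)} (h : TraceRel X Y) :
    TraceRel (P⁻¹ * X * P) (P⁻¹ * Y * P) := by
  have hXY : P⁻¹ * X * P * (P⁻¹ * Y * P) = P⁻¹ * (X * Y) * P := by group
  rw [TraceRel, hXY, comDet_conj, tr_conj, tr_conj, tr_conj]
  exact h

variable {p : ℕ} [Fact p.Prime]

lemma card_quadratic_le {F : Type*} [Field F] {s : Finset F} {a b c : F} (ha : a ≠ 0)
    (hs : ∀ x ∈ s, a * x ^ 2 + b * x + c = 0) : s.card ≤ 2 := by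
  by_contra! h
  obtain ⟨x, hx, y, hy, z, hz, hxy, hxz, hyz⟩ := Finset.two_lt_card.mp h
  have h1 : (x - y) * (a * (x + y) + b) = 0 := by linear_combination hs x hx - hs y hy
  have h2 : (x - z) * (a * (x + z) + b) = 0 := by linear_combination hs x hx - hs z hz
  have h3 := (mul_eq_zero.mp h1).resolve_left (sub_ne_zero.mpr hxy)
  have h4 := (mul_eq_zero.mp h2).resolve_left (sub_ne_zero.mpr hxz)
  have h5 : a * (y - z) = 0 := by linear_combination h3 - h4
  exact mul_ne_zero ha (sub_ne_zero.mpr hyz) h5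

lemma card_linear_le {F : Type*} [Field F] {s : Finset F} {a b : F} (ha : a ≠ 0)
    (hs : ∀ x ∈ s, a * x = b) : s.card ≤ 1 :=
  Finset.card_le_one.mpr fun x hx y hy ↦
    mul_left_cancel₀ ha ((hs x hx).trans (hs y hy).symm)

lemma natCast_ne_zero_of_lt {n : ℕ} (h0 : 0 < n) (hn : n < p) : (n : ZMod p) ≠ 0 := by
  rw [Ne, ZMod.natCast_eq_zero_iff]
  exact Nat.not_dvd_of_pos_of_lt h0 hn

/-- The upper triangular elements with a given diagonal related to a fixed element. -/
lemma card_upper_fiber_le (hp : 5 < p) {Y : SL(2, ZMod p)} (hY : Y 1 0 ≠ 0)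
    {U : Finset SL(2, ZMod p)} {m : ZMod p} (hU : ∀ g ∈ U, g 1 0 = 0 ∧ TraceRel Y g ∧ g 0 0 = m)
    (hm : m ≠ 0) :
    U.card + (if m ^ 2 = 1 then 2 else 0) ≤ 3 + (if m ^ 2 = -1 then p - 3 else 0) +
      (if (m ^ 2 + 1) ^ 2 = m ^ 2 then 2 else 0) := by
  classical
  have h2 : (2 : ZMod p) ≠ 0 := two_ne_zero_of_ne (by omega)
  have h3 : (3 : ZMod p) ≠ 0 := by exact_mod_cast natCast_ne_zero_of_lt (n := 3) (by simp) (by omega)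
  have h11 (g) (hg : g ∈ U) : g 1 1 = m⁻¹ := by
    have := det_eq g
    rw [(hU g hg).1, (hU g hg).2.2] at this
    field_simp
    linear_combination this
  set B := U.image (fun g ↦ g 0 1) with hB
  have hcard : U.card = B.card := by
    rw [hB, Finset.card_image_of_injOn]
    intro g hg h hh hgh
    apply sl_ext
    · rw [(hU g hg).2.2, (hU h hh).2.2]
    · exact hgh
    · rw [(hU g hg).1, (hU h hh).1]
    · rw [h11 g hg, h11 h hh]
  set c := Y 1 0 with hc
  set q := Y 0 0 * m + Y 1 1 * m⁻¹ with hq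
  have hBmem (t : ZMod p) (ht : t ∈ B) :
      -(t * c) ^ 2 - ((Y 0 0 - Y 1 1) * t - (m - m⁻¹) * Y 0 1) * ((m - m⁻¹) * c) = 0 ∨
      ((tr Y = 0 ∧ m + m⁻¹ = 0) ∨ (tr Y = 0 ∧ c * t + q = 0) ∨ (m + m⁻¹ = 0 ∧ c * t + q = 0)) ∨
      ((m + m⁻¹ = 0 ∨ (m + m⁻¹) ^ 2 = 1) ∧ (c * t + q = 0 ∨ (c * t + q) ^ 2 = 1)) := by
    obtain ⟨g, hg, rfl⟩ := Finset.mem_image.mp ht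
    obtain ⟨h10, h, h00⟩ := hU g hg
    have htg : tr g = m + m⁻¹ := by rw [tr, h00, h11 g hg]
    have htYg : tr (Y * g) = c * g 0 1 + q := by
      rw [tr, mul_00, mul_11, h10, h00, h11 g hg]; ring
    rw [TraceRel, htg, htYg, comDet_eq, h10, h00, h11 g hg] at h
    rcases h with h | h | h
    · left; rw [← h]; ring
    · exact Or.inr (Or.inl h)
    · exact Or.inr (Or.inr ⟨h.2.1, h.2.2.1⟩)
  have hm0 : m + m⁻¹ = 0 ↔ m ^ 2 = -1 := by
    constructor <;> intro h
    · field_simp at h; linear_combination h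
    · field_simp; linear_combination h
  have hm1 : (m + m⁻¹) ^ 2 = 1 ↔ (m ^ 2 + 1) ^ 2 = m ^ 2 := by
    constructor <;> intro h
    · field_simp at h; linear_combination h
    · field_simp; linear_combination h
  rw [hcard]
  by_cases hs1 : m ^ 2 = 1
  · have hinv : m⁻¹ = m := by field_simp; linear_combination -hs1
    have : B.card ≤ 1 := by
      refine card_linear_le (a := c) (b := 0) hY fun t ht ↦ ?_
      rcases hBmem t ht with h | (h | h | h) | h
      · rw [hinv, sub_self] at h
        have : (c * t) ^ 2 = 0 := by linear_combination -h
        exact pow_eq_zero_iff two_ne_zero |>.mp this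
      · exact absurd (by linear_combination hm0.mp h.2 - hs1) h2
      · rw [hq, hinv] at h; rw [tr] at h; linear_combination h.2 - m * h.1
      · exact absurd (by linear_combination hm0.mp h.1 - hs1) h2
      · rcases h.1 with h | h
        · exact absurd (by linear_combination hm0.mp h - hs1) h2
        · exact absurd (by linear_combination hm1.mp h - (m ^ 2 + 2) * hs1) h3
    rw [if_pos hs1]
    omega
  rw [if_neg hs1]
  by_cases hs2 : m ^ 2 = -1
  · have : B.card ≤ p := by simpa using Finset.card_le_univ B
    rw [if_pos hs2]
    omega
  rw [if_neg hs2]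
  rw [← hm0] at hs2
  set Q := B.filter (fun t ↦ -(t * c) ^ 2 -
    ((Y 0 0 - Y 1 1) * t - (m - m⁻¹) * Y 0 1) * ((m - m⁻¹) * c) = 0) with hQ
  have hQc : Q.card ≤ 2 := by
    apply card_quadratic_le (a := -c ^ 2) (b := -(Y 0 0 - Y 1 1) * ((m - m⁻¹) * c))
      (c := (m - m⁻¹) * Y 0 1 * ((m - m⁻¹) * c)) (neg_ne_zero.mpr (pow_ne_zero _ hY))
    intro t ht
    linear_combination (Finset.mem_filter.mp ht).2
  have hlin (e : ZMod p) : (B.filter (fun t ↦ c * t + q = e)).card ≤ 1 := by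
    refine card_linear_le (a := c) (b := e - q) hY fun t ht ↦ ?_
    linear_combination (Finset.mem_filter.mp ht).2
  by_cases hs3 : (m ^ 2 + 1) ^ 2 = m ^ 2
  · rw [if_pos hs3]
    have hsub : B ⊆ Q ∪ (B.filter (fun t ↦ c * t + q = 0) ∪ (B.filter (fun t ↦ c * t + q = 1) ∪
        B.filter (fun t ↦ c * t + q = -1))) := by
      intro t ht
      simp only [Finset.mem_union, Finset.mem_filter, hQ, ht, true_and]
      rcases hBmem t ht with h | (h | h | h) | h
      · exact Or.inl h
      · exact absurd h.2 hs2
      · exact Or.inr (Or.inl h.2)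
      · exact absurd h.1 hs2
      · rcases h.2 with h | h
        · exact Or.inr (Or.inl h)
        · rcases mul_self_eq_one_iff.mp ((pow_two _).symm.trans h) with h | h
          · exact Or.inr (Or.inr (Or.inl h))
          · exact Or.inr (Or.inr (Or.inr h))
    have h1 := Finset.card_le_card hsub
    have h2 := Finset.card_union_le Q (B.filter (fun t ↦ c * t + q = 0) ∪
      (B.filter (fun t ↦ c * t + q = 1) ∪ B.filter (fun t ↦ c * t + q = -1)))
    have h3 := Finset.card_union_le (B.filter (fun t ↦ c * t + q = 0))
      (B.filter (fun t ↦ c * t + q = 1) ∪ B.filter (fun t ↦ c * t + q = -1))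
    have h4 := Finset.card_union_le (B.filter (fun t ↦ c * t + q = 1))
      (B.filter (fun t ↦ c * t + q = -1))
    have := hlin 0
    have := hlin 1
    have := hlin (-1)
    omega
  · rw [if_neg hs3]
    rw [← hm1] at hs3
    have hsub : B ⊆ Q ∪ B.filter (fun t ↦ c * t + q = 0) := by
      intro t ht
      simp only [Finset.mem_union, Finset.mem_filter, hQ, ht, true_and]
      rcases hBmem t ht with h | (h | h | h) | h
      · exact Or.inl h
      · exact absurd h.2 hs2
      · exact Or.inr h.2
      · exact absurd h.1 hs2
      · tauto
    have h1 := Finset.card_le_card hsub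
    have h2 := Finset.card_union_le Q (B.filter (fun t ↦ c * t + q = 0))
    have := hlin 0
    omega

lemma card_upper_le (hp : 5 < p) {Y : SL(2, ZMod p)} (hY : Y 1 0 ≠ 0)
    {U : Finset SL(2, ZMod p)} (hU : ∀ g ∈ U, g 1 0 = 0 ∧ TraceRel Y g) :
    U.card ≤ 5 * (p - 1) := by
  classical
  have h2 : (2 : ZMod p) ≠ 0 := two_ne_zero_of_ne (by omega)
  set T : Finset (ZMod p) := Finset.univ.erase 0 with hT
  have hTcard : T.card = p - 1 := by
    rw [hT, Finset.card_erase_of_mem (Finset.mem_univ _), Finset.card_univ, ZMod.card]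
  have hmaps : ∀ g ∈ U, g 0 0 ∈ T := by
    intro g hg
    rw [hT, Finset.mem_erase]
    refine ⟨fun h ↦ ?_, Finset.mem_univ _⟩
    have := det_eq g
    rw [h, (hU g hg).1] at this
    simp at this
  have hsum := Finset.card_eq_sum_card_fiberwise (f := fun g : SL(2, ZMod p) ↦ g 0 0) hmaps
  have hle : ∑ m ∈ T, ((U.filter (fun g ↦ g 0 0 = m)).card + (if m ^ 2 = 1 then 2 else 0)) ≤
      ∑ m ∈ T, (3 + (if m ^ 2 = -1 then p - 3 else 0) +
        (if (m ^ 2 + 1) ^ 2 = m ^ 2 then 2 else 0)) := by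
    refine Finset.sum_le_sum fun m hm ↦ card_upper_fiber_le hp hY (fun g hg ↦ ?_)
      (Finset.ne_of_mem_erase hm)
    have := Finset.mem_filter.mp hg
    exact ⟨(hU g this.1).1, (hU g this.1).2, this.2⟩
  rw [Finset.sum_add_distrib, ← hsum, Finset.sum_add_distrib, Finset.sum_add_distrib,
    ← Finset.sum_filter, ← Finset.sum_filter, ← Finset.sum_filter, Finset.sum_const,
    Finset.sum_const, Finset.sum_const, Finset.sum_const, hTcard] at hle
  simp only [smul_eq_mul] at hle
  have c1 : 2 ≤ (T.filter (fun m ↦ m ^ 2 = 1)).card := by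
    have : ({1, -1} : Finset (ZMod p)) ⊆ T.filter (fun m ↦ m ^ 2 = 1) := by
      intro m hm
      simp only [Finset.mem_insert, Finset.mem_singleton] at hm
      rcases hm with rfl | rfl <;> simp [hT]
    refine le_trans (le_of_eq ?_) (Finset.card_le_card this)
    rw [Finset.card_pair]
    intro h
    exact h2 (by linear_combination h)
  have c2 : (T.filter (fun m ↦ m ^ 2 = -1)).card ≤ 2 :=
    card_quadratic_le (a := 1) (b := 0) (c := 1) one_ne_zero fun m hm ↦ by
      linear_combination (Finset.mem_filter.mp hm).2
  have c3 : (T.filter (fun m ↦ (m ^ 2 + 1) ^ 2 = m ^ 2)).card ≤ 4 := by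
    have hsub : T.filter (fun m ↦ (m ^ 2 + 1) ^ 2 = m ^ 2) ⊆
        T.filter (fun m ↦ m ^ 2 + 1 = m) ∪ T.filter (fun m ↦ m ^ 2 + 1 = -m) := by
      intro m hm
      have := Finset.mem_filter.mp hm
      rw [Finset.mem_union, Finset.mem_filter, Finset.mem_filter]
      rcases sq_eq_sq_iff_eq_or_eq_neg.mp this.2 with h | h
      · exact Or.inl ⟨this.1, h⟩
      · exact Or.inr ⟨this.1, h⟩
    have h1 : (T.filter (fun m ↦ m ^ 2 + 1 = m)).card ≤ 2 :=
      card_quadratic_le (a := 1) (b := -1) (c := 1) one_ne_zero fun m hm ↦ by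
        linear_combination (Finset.mem_filter.mp hm).2
    have h2 : (T.filter (fun m ↦ m ^ 2 + 1 = -m)).card ≤ 2 :=
      card_quadratic_le (a := 1) (b := 1) (c := 1) one_ne_zero fun m hm ↦ by
        linear_combination (Finset.mem_filter.mp hm).2
    exact (Finset.card_le_card hsub).trans ((Finset.card_union_le _ _).trans (by omega))
  have c2' := Nat.mul_le_mul_right (p - 3) c2
  omega

lemma card_residual_le (hp : 5 < p) {D : SL(2, ZMod p)} (h01 : D 0 1 = 0) (h10 : D 1 0 = 0)
    (hne : D 0 0 ≠ D 1 1) (htr : tr D ≠ 0) {R : Finset SL(2, ZMod p)}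
    (hR : ∀ g ∈ R, g 0 1 ≠ 0 ∧ g 1 0 ≠ 0 ∧ TraceRel D g) : R.card ≤ 7 * (p - 1) := by
  classical
  have h2 : (2 : ZMod p) ≠ 0 := two_ne_zero_of_ne (by omega)
  have h3 : (3 : ZMod p) ≠ 0 := by exact_mod_cast natCast_ne_zero_of_lt (n := 3) (by simp) (by omega)
  set T : Finset (ZMod p) := Finset.univ.erase 0 with hT
  have hTcard : T.card = p - 1 := by
    rw [hT, Finset.card_erase_of_mem (Finset.mem_univ _), Finset.card_univ, ZMod.card]
  set ε := tr D with hε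
  set L : Finset (ZMod p × ZMod p) :=
    {(0, 0), (1, 0), (-1, 0), (0, 1), (0, -1), (1, ε), (-1, -ε)} with hL
  have hLcard : L.card ≤ 7 := by
    rw [hL]
    exact (Finset.card_insert_le _ _).trans (Nat.succ_le_succ Finset.card_le_six)
  have htD (g : SL(2, ZMod p)) : tr (D * g) = D 0 0 * g 0 0 + D 1 1 * g 1 1 := by
    rw [tr, mul_00, mul_11, h01, h10]; ring
  have : R.card ≤ (T ×ˢ L).card := by
    apply Finset.card_le_card_of_injOn (fun g ↦ (g 1 0, tr g, tr (D * g)))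
    · intro g hg
      obtain ⟨hb, hc, h⟩ := hR g hg
      simp only [Finset.coe_product, Set.mem_prod, Finset.mem_coe]
      refine ⟨by simpa [hT] using hc, ?_⟩
      rw [TraceRel, comDet_eq, h01, h10] at h
      rcases h with h | (h | h | h) | h
      · exfalso
        have : (D 0 0 - D 1 1) ^ 2 * (g 0 1 * g 1 0) = 0 := by linear_combination h
        exact mul_ne_zero (pow_ne_zero _ (sub_ne_zero.mpr hne)) (mul_ne_zero hb hc) this
      · exact absurd h.1 htr
      · exact absurd h.1 htr
      · rw [h.1, h.2]; simp [hL]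
      · obtain ⟨hD, hy, hz, hyz⟩ := h
        have hD := hD.resolve_left htr
        rw [← hε] at hD hyz
        generalize tr g = y at *
        generalize tr (D * g) = z at *
        have sq {a : ZMod p} (h : a = 0 ∨ a ^ 2 = 1) : a = 0 ∨ a = 1 ∨ a = -1 := by
          rcases h with h | h
          · exact Or.inl h
          · exact Or.inr (mul_self_eq_one_iff.mp ((pow_two _).symm.trans h))
        have hε' := mul_self_eq_one_iff.mp ((pow_two _).symm.trans hD)
        simp only [hL, Finset.mem_insert, Finset.mem_singleton, Prod.mk.injEq]
        rcases hε' with h | h <;> rw [h] at hyz ⊢ <;> rcases sq hy with rfl | rfl | rfl <;>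
          rcases sq hz with rfl | rfl | rfl <;> simp at hyz ⊢ <;> grind
    · intro g hg g' hg' h
      simp only [Prod.mk.injEq, htD] at h
      obtain ⟨hc, hy, hz⟩ := h
      rw [tr, tr] at hy
      have hd := det_eq g
      have hd' := det_eq g'
      have h00 : g 0 0 = g' 0 0 :=
        mul_left_cancel₀ (sub_ne_zero.mpr hne) (by linear_combination hz - D 1 1 * hy)
      have h11 : g 1 1 = g' 1 1 := by linear_combination hy - h00
      refine sl_ext h00 ?_ hc h11
      apply mul_right_cancel₀ (hR g hg).2.1
      rw [h00, h11] at hd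
      linear_combination -hd + hd' - g' 0 1 * hc
  rw [Finset.card_product, hTcard] at this
  exact this.trans (by rw [mul_comm]; gcongr)

lemma card_le_of_traceRel (hp : 5 < p) {S : Finset SL(2, ZMod p)}
    (hS : ∀ X ∈ S, ∀ Y ∈ S, TraceRel X Y) {D Y Z : SL(2, ZMod p)} (hD : D ∈ S)
    (h01 : D 0 1 = 0) (h10 : D 1 0 = 0) (hne : D 0 0 ≠ D 1 1) (htr : tr D ≠ 0)
    (hY : Y ∈ S) (hY10 : Y 1 0 ≠ 0) (hZ : Z ∈ S) (hZ01 : Z 0 1 ≠ 0) :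
    S.card ≤ 17 * (p - 1) := by
  classical
  have hU : (S.filter (fun g ↦ g 1 0 = 0)).card ≤ 5 * (p - 1) :=
    card_upper_le hp hY10 fun g hg ↦
      ⟨(Finset.mem_filter.mp hg).2, hS _ hY _ (Finset.mem_filter.mp hg).1⟩
  set w : SL(2, ZMod p) := ofEntries 0 1 (-1) 0 (by ring) with hw
  have hw10 (g : SL(2, ZMod p)) : (w⁻¹ * g * w) 1 0 = -g 0 1 := by
    simp [mul_10, mul_11, inv_10, inv_11, hw]
  have hL : (S.filter (fun g ↦ g 0 1 = 0)).card ≤ 5 * (p - 1) := by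
    rw [← Finset.card_image_of_injective (f := fun g ↦ w⁻¹ * g * w) _
      (fun a b h ↦ by simpa using h)]
    refine card_upper_le hp (Y := w⁻¹ * Z * w) (by rw [hw10]; simpa using hZ01) fun g hg' ↦ ?_
    obtain ⟨g, hg, rfl⟩ := Finset.mem_image.mp hg'
    rw [Finset.mem_filter] at hg
    exact ⟨by rw [hw10, hg.2, neg_zero], traceRel_conj w (hS _ hZ _ hg.1)⟩
  have hR : (S.filter (fun g ↦ g 0 1 ≠ 0 ∧ g 1 0 ≠ 0)).card ≤ 7 * (p - 1) :=
    card_residual_le hp h01 h10 hne htr fun g hg ↦ by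
      rw [Finset.mem_filter] at hg
      exact ⟨hg.2.1, hg.2.2, hS _ hD _ hg.1⟩
  have hsub : S ⊆ S.filter (fun g ↦ g 1 0 = 0) ∪ (S.filter (fun g ↦ g 0 1 = 0) ∪
      S.filter (fun g ↦ g 0 1 ≠ 0 ∧ g 1 0 ≠ 0)) := by
    intro g hg
    simp only [Finset.mem_union, Finset.mem_filter]
    tauto
  have h1 := Finset.card_le_card hsub
  have h2 := Finset.card_union_le (S.filter (fun g ↦ g 1 0 = 0))
    (S.filter (fun g ↦ g 0 1 = 0) ∪ S.filter (fun g ↦ g 0 1 ≠ 0 ∧ g 1 0 ≠ 0))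
  have h3 := Finset.card_union_le (S.filter (fun g ↦ g 0 1 = 0))
    (S.filter (fun g ↦ g 0 1 ≠ 0 ∧ g 1 0 ≠ 0))
  omega

end Counting

/-! ### Split elements and the main estimate -/

section Assembly

variable {p : ℕ} [Fact p.Prime]

lemma prod_X_sub_C_eq : ∏ a : ZMod p, (Polynomial.X - Polynomial.C a) =
    (Polynomial.X ^ p - Polynomial.X : Polynomial (ZMod p)) := by
  have h1 : 1 < p := (Fact.out : p.Prime).one_lt
  have hroots := FiniteField.roots_X_pow_card_sub_X (ZMod p)
  rw [ZMod.card] at hroots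
  have hdeg := FiniteField.X_pow_card_sub_X_natDegree_eq (ZMod p) h1
  have := Polynomial.prod_multiset_X_sub_C_of_monic_of_roots_card_eq
    (p := (Polynomial.X ^ p - Polynomial.X : Polynomial (ZMod p)))
    (Polynomial.monic_X_pow_sub (by rw [Polynomial.degree_X]; exact_mod_cast h1))
    (by rw [hroots, hdeg]; simp [ZMod.card])
  rw [hroots] at this
  exact this

/-- An element of `SL(2, ZMod p)` fixed by the `p`-th power map has an eigenvalue in `ZMod p`. -/
lemma exists_eigenvalue {X : SL(2, ZMod p)} (h : X ^ p = X) :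
    ∃ l : ZMod p, l ^ 2 - tr X * l + 1 = 0 := by
  let φ : Polynomial (ZMod p) →* ZMod p :=
    Matrix.detMonoidHom.comp (Polynomial.aeval X.1).toRingHom.toMonoidHom
  have hφ : φ (∏ a : ZMod p, (Polynomial.X - Polynomial.C a)) = 0 := by
    have hX : X.1 ^ p = X.1 := by
      rw [← Matrix.SpecialLinearGroup.coe_pow, h]
    rw [prod_X_sub_C_eq]
    simp [φ, hX]
  rw [map_prod, Finset.prod_eq_zero_iff] at hφ
  obtain ⟨a, -, ha⟩ := hφ
  refine ⟨a, ?_⟩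
  have hd := det_eq X
  simp only [φ, MonoidHom.comp_apply, Matrix.coe_detMonoidHom] at ha
  have : (X.1 - algebraMap (ZMod p) _ a).det = 0 := by simpa using ha
  rw [Matrix.det_fin_two] at this
  simp only [Matrix.sub_apply, Matrix.algebraMap_matrix_apply, Fin.isValue, ↓reduceIte,
    Algebra.algebraMap_self, RingHom.id_apply, zero_ne_one, one_ne_zero, sub_zero] at this
  rw [tr]
  linear_combination this - hd

lemma exists_conj_diagonal {X : SL(2, ZMod p)} (hp : p ≠ 2) (h : X ^ p = X ∨ X ^ p = -X)
    (htr : tr X ≠ 0) (h1 : X ≠ 1) (h2 : X ≠ -1) :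
    ∃ Q : SL(2, ZMod p), (Q⁻¹ * X * Q) 0 1 = 0 ∧ (Q⁻¹ * X * Q) 1 0 = 0 ∧
      (Q⁻¹ * X * Q) 0 0 ≠ (Q⁻¹ * X * Q) 1 1 := by
  have hodd : Odd p := (Fact.out : p.Prime).odd_of_ne_two hp
  have hXp : X ^ p = X := by
    refine h.resolve_right fun h ↦ htr ?_
    have ht : tr (X ^ p) = tr X := by
      rw [tr_eq_trace, tr_eq_trace, Matrix.SpecialLinearGroup.coe_pow, ZMod.trace_pow_card,
        ZMod.pow_card]
    rw [h, tr_neg] at ht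
    have : 2 * tr X = 0 := by linear_combination -ht
    exact (mul_eq_zero.mp this).resolve_left (two_ne_zero_of_ne hp)
  obtain ⟨l, hl⟩ := exists_eigenvalue hXp
  obtain ⟨P, hP⟩ := exists_conj_upper hl
  set Y := P⁻¹ * X * P with hY
  have hYp : Y ^ p = Y := by
    have := conj_pow (a := P⁻¹) (b := X) (i := p)
    rw [inv_inv, hXp] at this
    exact this
  have hXY : X = P * Y * P⁻¹ := by rw [hY]; group
  have hne : Y 0 0 ≠ Y 1 1 := by
    intro heq
    have hd := det_eq Y
    rw [hP, heq] at hd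
    have : Y 1 1 = 1 ∨ Y 1 1 = -1 := mul_self_eq_one_iff.mp (by linear_combination hd)
    rcases this with h11 | h11
    · have hu : Y = upper (Y 0 1) := by
        apply sl_ext <;> simp [upper, h11, hP, heq]
      rw [hu, upper_pow, CharP.cast_eq_zero, zero_mul] at hYp
      have : Y = 1 := by
        rw [hu, ← hYp]; apply sl_ext <;> simp [upper]
      rw [this] at hXY
      exact h1 (by rw [hXY]; group)
    · have hu : Y = -upper (-Y 0 1) := by
        apply sl_ext <;> simp [upper, h11, hP, heq]
      rw [hu, hodd.neg_pow, upper_pow, CharP.cast_eq_zero, zero_mul] at hYp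
      have : Y = -1 := by
        rw [hu, ← hYp]; apply sl_ext <;> simp [upper]
      rw [this] at hXY
      exact h2 (by rw [hXY, mul_neg, neg_mul, mul_one, mul_inv_cancel])
  have hne' := sub_ne_zero.mpr hne
  set t := -Y 0 1 / (Y 0 0 - Y 1 1) with ht
  refine ⟨P * upper t, ?_⟩
  rw [show (P * upper t)⁻¹ * X * (P * upper t) = (upper t)⁻¹ * Y * upper t by rw [hY]; group]
  have e1 : (upper t) 0 0 = 1 := rfl
  have e2 : (upper t) 0 1 = t := rfl
  have e3 : (upper t) 1 0 = 0 := rfl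
  have e4 : (upper t) 1 1 = 1 := rfl
  simp only [mul_00, mul_01, mul_10, mul_11, inv_00, inv_01, inv_10, inv_11, e1, e2, e3, e4, hP]
  refine ⟨?_, by ring, ?_⟩
  · rw [ht]; field_simp; ring
  · intro h; exact hne (by linear_combination h)

/-- A maximal coclique that is not a maximal subgroup meets the complement of every
Borel subgroup. -/
lemma exists_notMem_borel {A : Set PSL(2, ZMod p)} (hA : IsMaximalCoclique A)
    (hnotmax : ∀ M : Subgroup PSL(2, ZMod p), IsCoatom M → A ≠ (M : Set PSL(2, ZMod p)))
    (P : SL(2, ZMod p)) :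
    ∃ Y, QuotientGroup.mk' (Subgroup.center SL(2, ZMod p)) Y ∈ A ∧ (P⁻¹ * Y * P) 1 0 ≠ 0 := by
  by_contra! hcon
  set M := (borel P).map (QuotientGroup.mk' (Subgroup.center SL(2, ZMod p)))
  have hM : IsCoatom M := isCoatom_map_borel P
  refine hnotmax M hM (hA.2 _ (fun g hg h hh htop ↦ hM.1 ?_) fun a ha ↦ ?_)
  · rw [eq_top_iff, ← htop, Subgroup.closure_le]
    rintro z (rfl | rfl)
    · exact hg
    · exact hh
  · obtain ⟨Y, rfl⟩ := QuotientGroup.mk'_surjective _ a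
    exact Subgroup.mem_map_of_mem _ (mem_borel.mpr (hcon Y ha))

lemma traceRel_of_isCoclique (hp : p ≠ 2) (hs2 : ¬ IsSquare (2 : ZMod p))
    (hs5 : ¬ IsSquare (5 : ZMod p)) {A : Set PSL(2, ZMod p)} (hA : IsCoclique A)
    {X Y : SL(2, ZMod p)} (hX : QuotientGroup.mk' (Subgroup.center SL(2, ZMod p)) X ∈ A)
    (hY : QuotientGroup.mk' (Subgroup.center SL(2, ZMod p)) Y ∈ A) : TraceRel X Y := by
  set π := QuotientGroup.mk' (Subgroup.center SL(2, ZMod p))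
  apply traceRel_of_mem hp hs2 hs5 (H := (Subgroup.closure {π X, π Y}).comap π)
  · rw [Subgroup.mem_comap, mk_eq_one.mpr (Or.inr rfl)]
    exact one_mem _
  · intro htop
    refine hA _ hX _ hY ?_
    rw [← Subgroup.map_comap_eq_self_of_surjective (QuotientGroup.mk'_surjective _)
      (Subgroup.closure {π X, π Y}), htop, ← MonoidHom.range_eq_map,
      MonoidHom.range_eq_top.mpr (QuotientGroup.mk'_surjective _)]
  · exact Subgroup.subset_closure (by simp)
  · exact Subgroup.subset_closure (by simp)

lemma two_mul_ncard_le (hp : p ≠ 2) (A : Set PSL(2, ZMod p)) {S : Finset SL(2, ZMod p)}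
    (hS : ∀ X, X ∈ S ↔ QuotientGroup.mk' (Subgroup.center SL(2, ZMod p)) X ∈ A) :
    2 * A.ncard ≤ S.card := by
  classical
  set π := QuotientGroup.mk' (Subgroup.center SL(2, ZMod p))
  obtain ⟨s, hs⟩ := (QuotientGroup.mk'_surjective (Subgroup.center SL(2, ZMod p))).hasRightInverse
  have hneg (X : SL(2, ZMod p)) : π (-X) = π X := by
    rw [← neg_one_mul, map_mul, mk_eq_one.mpr (Or.inr rfl), one_mul]
  have hne (X : SL(2, ZMod p)) : -X ≠ X := by
    intro h
    apply neg_one_ne_one (two_ne_zero_of_ne (p := p) hp)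
    rw [← neg_one_mul] at h
    exact mul_eq_right.mp h
  set T := A.toFinite.toFinset
  have hdisj : Disjoint (T.image s) (T.image fun a ↦ -s a) := by
    rw [Finset.disjoint_left]
    rintro _ ha hb
    obtain ⟨a, -, rfl⟩ := Finset.mem_image.mp ha
    obtain ⟨b, -, hb⟩ := Finset.mem_image.mp hb
    have : b = a := by
      have := congr_arg π hb
      rwa [hneg, hs, hs] at this
    exact hne _ (this ▸ hb)
  have hsub : T.image s ∪ T.image (fun a ↦ -s a) ⊆ S := by
    intro X hX
    rw [hS]
    rcases Finset.mem_union.mp hX with h | h <;> obtain ⟨a, ha, rfl⟩ := Finset.mem_image.mp h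
    · rw [hs]; exact A.toFinite.mem_toFinset.mp ha
    · rw [hneg, hs]; exact A.toFinite.mem_toFinset.mp ha
  have := Finset.card_le_card hsub
  rw [Finset.card_union_of_disjoint hdisj, Finset.card_image_of_injective _ hs.injective,
    Finset.card_image_of_injective (f := fun a ↦ -s a) _
      (neg_injective.comp hs.injective),
    ← Set.ncard_eq_toFinset_card A] at this
  omega

end Assembly

end CocliqueBound

open CocliqueBound

theorem coclique_bound_main4a (p : ℕ) (hp : p.Prime) (hp2 : 5 < p)
    (A : Set PSL(2, ZMod p)) (hA : IsMaximalCoclique A)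
    (hnotmax : ∀ M : Subgroup PSL(2, ZMod p), IsCoatom M → A ≠ (M : Set PSL(2, ZMod p)))
    (x : PSL(2, ZMod p)) (hxA : x ∈ A) (hx2 : 2 < orderOf x)
    (hxdvd : orderOf x ∣ p - 1)
    (hA4 : HasMaximalSubgroupIsoTo PSL(2, ZMod p) (alternatingGroup (Fin 4))) :
    2 * A.ncard ≤ 17 * (p - 1) := by
  classical
  have : Fact p.Prime := ⟨hp⟩
  have hpne : p ≠ 2 := by omega
  obtain ⟨M, hM, ⟨e⟩⟩ := hA4
  obtain ⟨hs2, hs5⟩ := not_isSquare_of_alternating hp2 hM e.symm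
  set π := QuotientGroup.mk' (Subgroup.center SL(2, ZMod p))
  obtain ⟨X, rfl⟩ := QuotientGroup.mk'_surjective _ x
  have hXX : X * X ≠ 1 ∧ X * X ≠ -1 := by
    rw [← not_or, ← mk_eq_one, map_mul, ← pow_two]
    intro h
    exact absurd (orderOf_le_of_pow_eq_one two_pos h) (by omega)
  have htr : tr X ≠ 0 := fun h ↦ hXX.2 (sq_of_tr_zero h)
  have hXp : X ^ p = X ∨ X ^ p = -X := by
    have h := orderOf_dvd_iff_pow_eq_one.mp hxdvd
    rw [← map_pow, mk_eq_one] at h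
    rw [show X ^ p = X ^ (p - 1) * X by rw [← pow_succ, Nat.sub_add_cancel (by omega)]]
    rcases h with h | h
    · exact Or.inl (by rw [h, one_mul])
    · exact Or.inr (by rw [h, neg_one_mul])
  obtain ⟨Q, h01, h10, hne⟩ := exists_conj_diagonal hpne hXp htr
    (fun h ↦ hXX.1 (by rw [h, one_mul])) (fun h ↦ hXX.1 (by rw [h, neg_mul_neg, one_mul]))
  obtain ⟨Y, hYA, hY⟩ := exists_notMem_borel hA hnotmax Q
  obtain ⟨Z, hZA, hZ⟩ := exists_notMem_borel hA hnotmax (Q * ofEntries 0 1 (-1) 0 (by ring))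
  set S : Finset SL(2, ZMod p) := Finset.univ.filter (fun g ↦ π g ∈ A) with hS
  have hmem (g : SL(2, ZMod p)) : g ∈ S ↔ π g ∈ A := by simp [hS]
  refine (two_mul_ncard_le hpne A hmem).trans ?_
  rw [← Finset.card_image_of_injective (f := fun g ↦ Q⁻¹ * g * Q) S
    (fun a b h ↦ by simpa using h)]
  have himage {g : SL(2, ZMod p)} (hg : π g ∈ A) :
      Q⁻¹ * g * Q ∈ S.image (fun g ↦ Q⁻¹ * g * Q) :=
    Finset.mem_image_of_mem _ ((hmem g).mpr hg)
  refine card_le_of_traceRel hp2 ?_ (himage hxA) h01 h10 hne (by rwa [tr_conj]) (himage hYA) hY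
    (himage hZA) ?_
  · rintro _ ha' _ hb'
    obtain ⟨a, ha, rfl⟩ := Finset.mem_image.mp ha'
    obtain ⟨b, hb, rfl⟩ := Finset.mem_image.mp hb'
    exact traceRel_conj Q
      (traceRel_of_isCoclique hpne hs2 hs5 hA.1 ((hmem a).mp ha) ((hmem b).mp hb))
  · intro h
    apply hZ
    rw [mul_inv_rev, show ∀ w : SL(2, ZMod p), w⁻¹ * Q⁻¹ * Z * (Q * w) =
      w⁻¹ * (Q⁻¹ * Z * Q) * w from fun w ↦ by group]
    generalize Q⁻¹ * Z * Q = g at h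
    simp [mul_10, mul_11, inv_10, inv_11, h]
end

section
/- Let p > 2 be a prime, G = PSL₂(p), and let A ⊆ G be a maximal coclique which is not the underlying set of a maximal subgroup of G. Suppose A contains an element x of order greater than 2 whose order divides p − 1. If G contains A₅ or S₄ (or both) as a maximal subgroup, then |A| ≤ (129/2)(p − 1) + 2, i.e. 2·|A| ≤ 129(p − 1) + 4. -/
open scoped MatrixGroups

open MulAction

section TwoFixedPoints

variable {G X : Type*} [Group G] [MulAction G X] {Z : Subgroup G}

theorem pow_relIndex_stabilizer_mem [Z.Normal] {g : G} {x : X} (hg : g • x = x) :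
    g ^ Z.relIndex (stabilizer G x) ∈ Z := by
  have h := Subgroup.pow_index_mem (Z.subgroupOf (stabilizer G x)) ⟨g, hg⟩
  simpa [Subgroup.mem_subgroupOf, Subgroup.relIndex] using h

theorem card_orbit_mul_relIndex_stabilizer (hZ : ∀ g ∈ Z, ∀ x : X, g • x = x) (x : X) :
    Z.relIndex (stabilizer G x) * (orbit G x).ncard = Z.index := by
  rw [← index_stabilizer]
  exact Subgroup.relIndex_mul_index fun g hg => hZ g hg x

theorem two_le_relIndex_stabilizer [Finite G] (x : X) (hx : ∃ g ∉ Z, g • x = x) :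
    2 ≤ Z.relIndex (stabilizer G x) := by
  obtain ⟨g, hg, hgx⟩ := hx
  have h0 : Z.relIndex (stabilizer G x) ≠ 0 := Subgroup.FiniteIndex.index_ne_zero
  have h1 : Z.relIndex (stabilizer G x) ≠ 1 := fun h =>
    hg (Subgroup.relIndex_eq_one.1 h hgx)
  omega

/-- Burnside's count for an action in which each `g ∉ Z` has exactly two fixed points and
`Z` acts trivially. -/
theorem card_add_two_mul_index [Finite G] [Finite X] (hZ : ∀ g ∈ Z, ∀ x : X, g • x = x)
    (h2 : ∀ g ∉ Z, Nat.card (fixedBy X g) = 2) :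
    Nat.card X + 2 * Z.index = Nat.card (orbitRel.Quotient G X) * Z.index + 2 := by
  classical
  have := Fintype.ofFinite G
  have := Fintype.ofFinite X
  have := Fintype.ofFinite (orbitRel.Quotient G X)
  have hB := sum_card_fixedBy_eq_card_orbits_mul_card_group G X
  have hsplit : ∑ g : G, Fintype.card (fixedBy X g)
      = Nat.card Z * Nat.card X + (Nat.card G - Nat.card Z) * 2 := by
    rw [← Finset.sum_filter_add_sum_filter_not Finset.univ (· ∈ Z)]
    have hc : (Finset.univ.filter (· ∈ Z)).card = Nat.card Z := by
      rw [Nat.card_eq_fintype_card, Fintype.card_subtype]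
    congr 1
    · rw [Finset.sum_congr rfl (g := fun _ => Nat.card X), Finset.sum_const, hc, smul_eq_mul]
      intro g hg
      rw [← Nat.card_eq_fintype_card]
      refine Nat.card_congr (Equiv.subtypeUnivEquiv fun x => hZ g (by simpa using hg) x)
    · rw [Finset.sum_congr rfl (g := fun _ => 2), Finset.sum_const, smul_eq_mul,
        Finset.filter_not, Finset.card_sdiff_of_subset (Finset.filter_subset _ _), hc,
        Finset.card_univ, Nat.card_eq_fintype_card (α := G)]
      intro g hg
      rw [← Nat.card_eq_fintype_card]
      exact h2 g (by simpa using hg)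
  rw [hsplit, ← Nat.card_eq_fintype_card, ← Nat.card_eq_fintype_card,
    ← Subgroup.card_mul_index Z] at hB
  have he : 0 < Nat.card Z := Nat.card_pos
  have hi : 1 ≤ Z.index := Nat.one_le_iff_ne_zero.2 Subgroup.FiniteIndex.index_ne_zero
  obtain ⟨m, hm⟩ := Nat.exists_eq_add_of_le hi
  rw [hm] at hB ⊢
  have h3 : Nat.card Z * (1 + m) - Nat.card Z = Nat.card Z * m := by
    rw [mul_add, mul_one, Nat.add_sub_cancel_left]
  rw [h3] at hB
  refine Nat.eq_of_mul_eq_mul_left he ?_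
  linarith

theorem exists_swapped_pair [Finite G] [Finite X] [Z.Normal]
    (h2 : ∀ g ∉ Z, Nat.card (fixedBy X g) = 2) (x₀ : X) (hx₀ : (orbit G x₀).ncard = 2)
    (hother : ∀ x ∉ orbit G x₀, Z.relIndex (stabilizer G x) = 2) :
    ∃ x y : X, x ≠ y ∧ (∀ g : G, g • x = x ∨ g • x = y) ∧ (∀ g : G, g • y = x ∨ g • y = y) ∧
      ∀ g : G, g ^ 2 ∉ Z → g • x = x ∧ g • y = y := by
  obtain ⟨x, y, hxy, horb⟩ := Set.ncard_eq_two.1 hx₀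
  have hmem : ∀ z, z ∈ orbit G x₀ ↔ z = x ∨ z = y := fun z => by rw [horb]; simp
  have hx : ∀ g : G, g • x = x ∨ g • x = y := fun g =>
    (hmem _).1 (mem_orbit_of_mem_orbit g ((hmem _).2 (.inl rfl)))
  have hy : ∀ g : G, g • y = x ∨ g • y = y := fun g =>
    (hmem _).1 (mem_orbit_of_mem_orbit g ((hmem _).2 (.inr rfl)))
  refine ⟨x, y, hxy, hx, hy, fun g hg => ?_⟩
  have hgZ : g ∉ Z := fun h => hg (pow_mem h 2)
  obtain ⟨z, hz⟩ : Nonempty (fixedBy X g) := (Nat.card_pos_iff.1 (by rw [h2 g hgZ]; simp)).1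
  have hz' : g • z = z := hz
  by_cases hzo : z ∈ orbit G x₀
  · rcases (hmem z).1 hzo with rfl | rfl
    · refine ⟨hz', (hy g).resolve_left fun h => hxy (smul_left_cancel g (hz'.trans h.symm))⟩
    · refine ⟨(hx g).resolve_right fun h => hxy (smul_left_cancel g (h.trans hz'.symm)), hz'⟩
  · exact absurd (hother z hzo ▸ pow_relIndex_stabilizer_mem hz') hg

/-- A finite group in which every element outside a normal subgroup `Z` has exactly two fixed
points, `Z` acting trivially: it fixes a point, or preserves a pair of points, or
has only elements of order at most five modulo `Z`. -/
theorem two_fixed_points_trichotomy [Finite G] [Finite X] [Z.Normal]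
    (hZ : ∀ g ∈ Z, ∀ x : X, g • x = x)
    (h2 : ∀ g ∉ Z, Nat.card (fixedBy X g) = 2) (hX : ∀ x : X, ∃ g ∉ Z, g • x = x) :
    (∃ x : X, ∀ g : G, g • x = x) ∨
    (∃ x y : X, x ≠ y ∧ (∀ g : G, g • x = x ∨ g • x = y) ∧ (∀ g : G, g • y = x ∨ g • y = y) ∧
      ∀ g : G, g ^ 2 ∉ Z → g • x = x ∧ g • y = y) ∨
    ∀ g : G, ∃ k, 0 < k ∧ k ≤ 5 ∧ g ^ k ∈ Z := by
  classical
  have := Fintype.ofFinite (orbitRel.Quotient G X)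
  set k : orbitRel.Quotient G X → ℕ := fun ω => (orbit G ω.out).ncard with hk
  set n : orbitRel.Quotient G X → ℕ := fun ω => Z.relIndex (stabilizer G ω.out) with hn
  have hm0 : 0 < Z.index := Nat.pos_of_ne_zero Subgroup.FiniteIndex.index_ne_zero
  have hkn : ∀ ω, n ω * k ω = Z.index := fun ω => card_orbit_mul_relIndex_stabilizer hZ _
  have hn2 : ∀ ω, 2 ≤ n ω := fun ω => two_le_relIndex_stabilizer _ (hX _)
  have hk0 : ∀ ω, 0 < k ω := fun ω => Nat.pos_of_ne_zero fun h => by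
    have := hkn ω; rw [h] at this; omega
  have hkm : ∀ ω c, c ≤ n ω → c * k ω ≤ Z.index := fun ω c hc =>
    (Nat.mul_le_mul_right _ hc).trans (hkn ω).le
  have hkm2 : ∀ ω, 2 * k ω ≤ Z.index := fun ω => hkm ω 2 (hn2 ω)
  have hout : ∀ x : X, x ∈ orbit G (Quotient.out (s := orbitRel G X) ⟦x⟧) := fun x =>
    (orbitRel G X).symm (Quotient.mk_out x)
  have hrel : ∀ x : X, Z.relIndex (stabilizer G x) = n ⟦x⟧ := fun x => by
    have h1 := card_orbit_mul_relIndex_stabilizer hZ x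
    rw [orbit_eq_iff.2 (hout x), ← hkn ⟦x⟧] at h1
    exact Nat.eq_of_mul_eq_mul_right (hk0 _) h1
  have hsum : Nat.card X = ∑ ω, k ω := by
    rw [Nat.card_congr (selfEquivSigmaOrbits G X), Nat.card_sigma]
    rfl
  have hB := card_add_two_mul_index hZ h2
  rw [hsum, Nat.card_eq_fintype_card, ← Finset.card_univ] at hB
  have hr : (Finset.univ : Finset (orbitRel.Quotient G X)).card ≤ 3 := by
    have h1 : ∑ ω, 2 * k ω ≤ (Finset.univ : Finset (orbitRel.Quotient G X)).card * Z.index := by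
      rw [← smul_eq_mul, ← Finset.sum_const]
      exact Finset.sum_le_sum fun ω _ => hkm2 ω
    rw [← Finset.mul_sum] at h1
    by_contra! h
    nlinarith
  have hpair : ∀ a b c : orbitRel.Quotient G X, Finset.univ = {a, b, c} → n a = 2 → n b = 2 →
      k c = 2 → ∃ x y : X, x ≠ y ∧ (∀ g : G, g • x = x ∨ g • x = y) ∧
        (∀ g : G, g • y = x ∨ g • y = y) ∧ ∀ g : G, g ^ 2 ∉ Z → g • x = x ∧ g • y = y := by
    intro a b c huniv ha hb hc
    refine exists_swapped_pair h2 c.out hc fun x hx => ?_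
    rw [hrel]
    have hmem := Finset.mem_univ (⟦x⟧ : orbitRel.Quotient G X)
    rw [huniv] at hmem
    simp only [Finset.mem_insert, Finset.mem_singleton] at hmem
    rcases hmem with h | h | h
    · rw [h, ha]
    · rw [h, hb]
    · exact absurd (h ▸ hout x) hx
  obtain hr | hr | hr | hr : (Finset.univ : Finset (orbitRel.Quotient G X)).card = 0 ∨
      (Finset.univ : Finset (orbitRel.Quotient G X)).card = 1 ∨
      (Finset.univ : Finset (orbitRel.Quotient G X)).card = 2 ∨
      (Finset.univ : Finset (orbitRel.Quotient G X)).card = 3 := by omega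
  · rw [hr, Finset.card_eq_zero.1 hr, Finset.sum_empty] at hB
    have hZtop : Z = ⊤ := Subgroup.index_eq_one.1 (by omega)
    exact .inr (.inr fun g => ⟨1, by simp [hZtop]⟩)
  · obtain ⟨a, ha⟩ := Finset.card_eq_one.1 hr
    rw [hr, ha, Finset.sum_singleton] at hB
    have := hkm2 a; have := hk0 a
    omega
  · obtain ⟨a, b, hab, huniv⟩ := Finset.card_eq_two.1 hr
    rw [hr, huniv, Finset.sum_pair hab] at hB
    have := hk0 a; have := hk0 b
    have hka : k a = 1 := by omega
    refine .inl ⟨a.out, fun g => ?_⟩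
    obtain ⟨x, hx⟩ := Set.ncard_eq_one.1 hka
    have h1 : a.out ∈ orbit G a.out := mem_orbit_self _
    have h3 : g • a.out ∈ orbit G a.out := mem_orbit _ _
    rw [hx] at h1 h3
    exact h3.trans h1.symm
  · obtain ⟨a, b, c, hab, hac, hbc, huniv⟩ := Finset.card_eq_three.1 hr
    have hB' : k a + k b + k c = Z.index + 2 := by
      rw [hr, huniv, Finset.sum_insert (by simp [hab, hac]), Finset.sum_pair hbc] at hB
      omega
    have := hn2 a; have := hn2 b; have := hn2 c
    have := hkm2 a; have := hkm2 b; have := hkm2 c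
    by_cases hab2 : n a = 2 ∧ n b = 2
    · have h1 := hkn a; have h3 := hkn b
      rw [hab2.1] at h1; rw [hab2.2] at h3
      exact .inr (.inl (hpair a b c huniv hab2.1 hab2.2 (by omega)))
    by_cases hac2 : n a = 2 ∧ n c = 2
    · have h1 := hkn a; have h3 := hkn c
      rw [hac2.1] at h1; rw [hac2.2] at h3
      exact .inr (.inl (hpair a c b (by rw [huniv, Finset.pair_comm]) hac2.1 hac2.2 (by omega)))
    by_cases hbc2 : n b = 2 ∧ n c = 2
    · have h1 := hkn b; have h3 := hkn c
      rw [hbc2.1] at h1; rw [hbc2.2] at h3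
      exact .inr (.inl (hpair b c a (by
        rw [huniv, Finset.insert_comm, Finset.pair_comm a c]) hbc2.1 hbc2.2 (by omega)))
    have := hkm a 3; have := hkm b 3; have := hkm c 3
    have := hkm a 6; have := hkm b 6; have := hkm c 6
    have hn5 : n a ≤ 5 ∧ n b ≤ 5 ∧ n c ≤ 5 := by omega
    refine .inr (.inr fun g => ?_)
    by_cases hg : g ∈ Z
    · exact ⟨1, by simp [hg]⟩
    obtain ⟨z, hz⟩ : Nonempty (fixedBy X g) := (Nat.card_pos_iff.1 (by rw [h2 g hg]; simp)).1
    refine ⟨n ⟦z⟧, by have := hn2 ⟦z⟧; omega, ?_, hrel z ▸ pow_relIndex_stabilizer_mem hz⟩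
    have hmem := Finset.mem_univ (⟦z⟧ : orbitRel.Quotient G X)
    rw [huniv] at hmem
    simp only [Finset.mem_insert, Finset.mem_singleton] at hmem
    rcases hmem with h | h | h <;> rw [h] <;> omega

end TwoFixedPoints

section SL2

open Matrix

namespace SLTwo

variable {F : Type*} [Field F]

theorem det_eq (g : SL(2, F)) : g 0 0 * g 1 1 - g 0 1 * g 1 0 = 1 := by
  rw [← det_fin_two]; exact g.2

theorem mul_apply (g h : SL(2, F)) (i j : Fin 2) :
    (g * h) i j = g i 0 * h 0 j + g i 1 * h 1 j := by
  change (g.1 * h.1) i j = _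
  rw [Matrix.mul_apply, Fin.sum_univ_two]

theorem inv_apply_zero_zero (g : SL(2, F)) : g⁻¹ 0 0 = g 1 1 := by
  simp [SpecialLinearGroup.SL2_inv_expl]

theorem inv_apply_zero_one (g : SL(2, F)) : g⁻¹ 0 1 = - g 0 1 := by
  simp [SpecialLinearGroup.SL2_inv_expl]

theorem inv_apply_one_zero (g : SL(2, F)) : g⁻¹ 1 0 = - g 1 0 := by
  simp [SpecialLinearGroup.SL2_inv_expl]

theorem inv_apply_one_one (g : SL(2, F)) : g⁻¹ 1 1 = g 0 0 := by
  simp [SpecialLinearGroup.SL2_inv_expl]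

/-- The trace of an element of `SL(2, F)`. -/
def tr (g : SL(2, F)) : F := g 0 0 + g 1 1

theorem tr_conj (k g : SL(2, F)) : tr (k * g * k⁻¹) = tr g := by
  simp only [tr, mul_apply, inv_apply_zero_zero, inv_apply_zero_one, inv_apply_one_zero,
    inv_apply_one_one]
  linear_combination (g 0 0 + g 1 1) * det_eq k

theorem ext' {g h : SL(2, F)} (h00 : g 0 0 = h 0 0) (h01 : g 0 1 = h 0 1) (h10 : g 1 0 = h 1 0)
    (h11 : g 1 1 = h 1 1) : g = h := by
  ext i j
  fin_cases i <;> fin_cases j <;> assumption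

theorem mem_center_iff (g : SL(2, F)) :
    g ∈ Subgroup.center SL(2, F) ↔ g 0 1 = 0 ∧ g 1 0 = 0 ∧ g 0 0 = g 1 1 := by
  rw [Matrix.SpecialLinearGroup.mem_center_iff]
  constructor
  · rintro ⟨r, -, hr⟩
    rw [← hr]
    simp
  · rintro ⟨h1, h2, h3⟩
    refine ⟨g 0 0, ?_, ?_⟩
    · have := det_eq g
      rw [h1, ← h3] at this
      simp only [Fintype.card_fin]
      linear_combination this
    · ext i j
      fin_cases i <;> fin_cases j <;> simp [h1, h2, h3]

/-- The matrix `[[a, b], [c, d]]` of determinant one. -/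
def mk (a b c d : F) (h : a * d - b * c = 1) : SL(2, F) := ⟨!![a, b; c, d], by simpa using h⟩

section mk

variable {a b c d : F} {h : a * d - b * c = 1}

@[simp] theorem mk_zero_zero : mk a b c d h 0 0 = a := rfl
@[simp] theorem mk_zero_one : mk a b c d h 0 1 = b := rfl
@[simp] theorem mk_one_zero : mk a b c d h 1 0 = c := rfl
@[simp] theorem mk_one_one : mk a b c d h 1 1 = d := rfl

end mk

/-- The matrix `[[1, s], [0, 1]]`. -/
def upper (s : F) : SL(2, F) := mk 1 s 0 1 (by simp)

@[simp] theorem upper_zero_zero (s : F) : upper s 0 0 = 1 := rfl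
@[simp] theorem upper_zero_one (s : F) : upper s 0 1 = s := rfl
@[simp] theorem upper_one_zero (s : F) : upper s 1 0 = 0 := rfl
@[simp] theorem upper_one_one (s : F) : upper s 1 1 = 1 := rfl

theorem upper_mul (s t : F) : upper s * upper t = upper (s + t) := by
  apply ext' <;> simp [mul_apply, add_comm]

theorem upper_pow (s : F) (n : ℕ) : upper s ^ n = upper (n * s) := by
  induction n with
  | zero => apply ext' <;> simp
  | succ n ih => rw [pow_succ, ih, upper_mul]; congr 1; push_cast; ring

theorem eq_top_of_unipotent_mem {p : ℕ} [Fact p.Prime] (hp : p ≠ 2) {H : Subgroup SL(2, ZMod p)}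
    {u h : SL(2, ZMod p)} (hu : u ∈ H) (hh : h ∈ H) (hu10 : u 1 0 = 0) (hud : u 0 0 = u 1 1)
    (hu01 : u 0 1 ≠ 0) (hh10 : h 1 0 ≠ 0) : H = ⊤ := by
  have h2 : (2 : ZMod p) ≠ 0 := Ring.two_ne_zero (by rwa [ZMod.ringChar_zmod_n])
  have hu1 : u 1 1 * u 1 1 = 1 := by
    have := det_eq u
    rw [hu10, hud] at this
    linear_combination this
  have hu1' : u 1 1 ≠ 0 := fun h => by simp [h] at hu1
  set s := 2 * u 1 1 * u 0 1 with hs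
  have hs0 : s ≠ 0 := mul_ne_zero (mul_ne_zero h2 hu1') hu01
  have hsH : upper s ∈ H := by
    have : upper s = u * u := by
      apply ext' <;> simp [mul_apply, hu10, hud, hu1]
      rw [hs]; ring
    rw [this]
    exact mul_mem hu hu
  have hU : ∀ t, upper t ∈ H := fun t => by
    have : upper t = upper s ^ (t / s).val := by
      rw [upper_pow, ZMod.natCast_zmod_val, div_mul_cancel₀ _ hs0]
    rw [this]
    exact pow_mem hsH _
  set c := h 1 0 with hc
  set w : SL(2, ZMod p) := mk 0 (-c⁻¹) c 0 (by simp [hh10]) with hw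
  have hwH : w ∈ H := by
    have : w = upper (-(h 0 0) / c) * h * upper (-(h 1 1) / c) := by
      have := det_eq h
      rw [← hc] at this
      apply ext' <;> simp [mul_apply, hw, ← hc] <;> grind
    rw [this]
    exact mul_mem (mul_mem (hU _) hh) (hU _)
  refine (Subgroup.eq_top_iff' H).2 fun g => ?_
  induction g using SL2.transvection_induction with
  | hmul A B hA hB => exact mul_mem hA hB
  | htransvec i j hij t =>
    fin_cases i <;> fin_cases j
    · exact absurd rfl hij
    · convert hU t using 1
      apply ext' <;> simp [SpecialLinearGroup.transvection_coe]
    · convert mul_mem (mul_mem hwH (hU (-t / c ^ 2))) (inv_mem hwH) using 1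
      apply ext' <;> simp [mul_apply, hw, SpecialLinearGroup.transvection_coe,
        inv_apply_zero_zero, inv_apply_zero_one, inv_apply_one_zero, inv_apply_one_one] <;>
        field_simp
    · exact absurd rfl hij

/-- In a proper subgroup of `SL(2, p)` with a noncentral element of trace `±2`, all
elements are simultaneously upper triangular. -/
theorem exists_conj_upper_triangular {p : ℕ} [Fact p.Prime] (hp : p ≠ 2)
    {H : Subgroup SL(2, ZMod p)} (hH : H ≠ ⊤) {u : SL(2, ZMod p)} (hu : u ∈ H)
    (hut : tr u ^ 2 = 4) (huc : u ∉ Subgroup.center SL(2, ZMod p)) :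
    ∃ k : SL(2, ZMod p), ∀ h ∈ H, (k * h * k⁻¹) 1 0 = 0 := by
  have h2 : (2 : ZMod p) ≠ 0 := Ring.two_ne_zero (by rwa [ZMod.ringChar_zmod_n])
  obtain ⟨k, hk⟩ : ∃ k : SL(2, ZMod p), (k * u * k⁻¹) 1 0 = 0 := by
    by_cases hc : u 1 0 = 0
    · exact ⟨1, by simpa using hc⟩
    · refine ⟨mk 0 (-1) 1 (-((u 0 0 - u 1 1) / (2 * u 1 0))) (by simp), ?_⟩
      have hd := det_eq u
      simp only [tr] at hut
      simp only [mul_apply, inv_apply_zero_zero, inv_apply_one_zero]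
      simp
      field_simp
      linear_combination 4 * hd - hut
  refine ⟨k, fun h hh => by_contra fun hne => hH ?_⟩
  have hu' : k * u * k⁻¹ ∈ H.map (MulAut.conj k).toMonoidHom := ⟨u, hu, rfl⟩
  have hh' : k * h * k⁻¹ ∈ H.map (MulAut.conj k).toMonoidHom := ⟨h, hh, rfl⟩
  have hd : (k * u * k⁻¹) 0 0 = (k * u * k⁻¹) 1 1 := by
    have h1 := det_eq (k * u * k⁻¹)
    rw [← tr_conj k, tr] at hut
    rw [hk] at h1
    have : ((k * u * k⁻¹) 0 0 - (k * u * k⁻¹) 1 1) ^ 2 = 0 := by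
      linear_combination hut - 4 * h1
    exact sub_eq_zero.1 (pow_eq_zero_iff two_ne_zero |>.1 this)
  have hb : (k * u * k⁻¹) 0 1 ≠ 0 := fun hb => huc <| by
    have := (mem_center_iff _).2 ⟨hb, hk, hd⟩
    simpa [mul_assoc] using (Subgroup.instNormalCenter).conj_mem _ this k⁻¹
  have htop := eq_top_of_unipotent_mem hp hu' hh' hk hd hb hne
  refine Subgroup.map_injective (f := (MulAut.conj k).toMonoidHom) (MulAut.conj k).injective ?_
  rw [htop, ← MonoidHom.range_eq_map]
  exact (MonoidHom.range_eq_top.2 (MulAut.conj k).surjective).symm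

open scoped OnePoint

/-- The projective line over the algebraic closure of `F`. -/
abbrev Line (F : Type*) [Field F] := OnePoint (AlgebraicClosure F)

open scoped Classical in
noncomputable instance : MulAction SL(2, F) (Line F) :=
  MulAction.compHom _
    (SpecialLinearGroup.toGL.comp (SpecialLinearGroup.map (algebraMap F (AlgebraicClosure F))))

local notation "ι" => algebraMap F (AlgebraicClosure F)

open scoped Classical in
theorem smul_infty (g : SL(2, F)) :
    g • (∞ : Line F) = if g 1 0 = 0 then ∞ else
      ((ι (g 0 0) / ι (g 1 0) : AlgebraicClosure F) : Line F) := by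
  classical
  have := OnePoint.smul_infty_eq_ite (SpecialLinearGroup.toGL (SpecialLinearGroup.map ι g))
  simp only [SpecialLinearGroup.coe_GL_coe_matrix, SpecialLinearGroup.map_apply_coe,
    RingHom.mapMatrix_apply, Matrix.map_apply, map_eq_zero] at this
  exact this.trans (by congr)

open scoped Classical in
theorem smul_coe (g : SL(2, F)) (z : AlgebraicClosure F) :
    g • (z : Line F) = if ι (g 1 0) * z + ι (g 1 1) = 0 then ∞ else
      (((ι (g 0 0) * z + ι (g 0 1)) / (ι (g 1 0) * z + ι (g 1 1)) : AlgebraicClosure F) :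
        Line F) := by
  classical
  have := OnePoint.smul_some_eq_ite
    (g := SpecialLinearGroup.toGL (SpecialLinearGroup.map ι g)) (k := z)
  simp only [SpecialLinearGroup.coe_GL_coe_matrix, SpecialLinearGroup.map_apply_coe,
    RingHom.mapMatrix_apply, Matrix.map_apply] at this
  exact this.trans (by congr)

theorem smul_infty_eq_self (g : SL(2, F)) : g • (∞ : Line F) = ∞ ↔ g 1 0 = 0 := by
  rw [smul_infty]
  split_ifs with h <;> simp [h]

theorem smul_infty_eq_coe (g : SL(2, F)) (z : AlgebraicClosure F) :
    g • (∞ : Line F) = z ↔ g 1 0 ≠ 0 ∧ ι (g 1 0) * z = ι (g 0 0) := by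
  rw [smul_infty]
  split_ifs with h
  · simp [h]
  · have h' : ι (g 1 0) ≠ 0 := by simpa using h
    rw [OnePoint.coe_eq_coe, div_eq_iff h', eq_comm, mul_comm]
    simp [h]

theorem smul_coe_eq_infty (g : SL(2, F)) (z : AlgebraicClosure F) :
    g • (z : Line F) = ∞ ↔ ι (g 1 0) * z + ι (g 1 1) = 0 := by
  rw [smul_coe]
  split_ifs with h <;> simp [h]

theorem smul_coe_eq_self (g : SL(2, F)) (z : AlgebraicClosure F) :
    g • (z : Line F) = z ↔ ι (g 1 0) * z ^ 2 + (ι (g 1 1) - ι (g 0 0)) * z - ι (g 0 1) = 0 := by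
  have hd : ι (g 0 0) * ι (g 1 1) - ι (g 0 1) * ι (g 1 0) = 1 := by
    rw [← map_mul, ← map_mul, ← map_sub, det_eq, map_one]
  rw [smul_coe]
  split_ifs with h
  · simp only [OnePoint.infty_ne_coe, false_iff]
    intro h2
    have h3 : ι (g 0 0) * z + ι (g 0 1) = 0 := by linear_combination z * h - h2
    by_cases hc : ι (g 1 0) = 0
    · rw [hc] at h hd; simp at h; simp [h] at hd
    · apply one_ne_zero (α := AlgebraicClosure F)
      linear_combination -hd + ι (g 0 0) * h - ι (g 1 0) * h3
  · rw [OnePoint.coe_eq_coe, div_eq_iff h, ← sub_eq_zero]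
    constructor <;> intro h <;> linear_combination -h

theorem smul_eq_self_of_mem_center {g : SL(2, F)} (hg : g ∈ Subgroup.center SL(2, F))
    (P : Line F) : g • P = P := by
  obtain ⟨h1, h2, h3⟩ := (mem_center_iff g).1 hg
  induction P using OnePoint.rec with
  | infty => rwa [smul_infty_eq_self]
  | coe z => rw [smul_coe_eq_self, h1, h2, h3]; simp

theorem card_fixedBy_line [NeZero (2 : F)] {g : SL(2, F)} (hg : tr g ^ 2 ≠ 4) :
    (fixedBy (Line F) g).ncard = 2 := by
  have hd := det_eq g
  rw [Set.ncard_eq_two]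
  by_cases hc : g 1 0 = 0
  · have had : g 0 0 ≠ g 1 1 := fun h => hg <| by
      rw [tr]; rw [hc, h] at hd; rw [h]; linear_combination 4 * hd
    have had' : ι (g 1 1) - ι (g 0 0) ≠ 0 := sub_ne_zero.2 fun h =>
      had ((algebraMap F (AlgebraicClosure F)).injective h).symm
    refine ⟨∞, ((ι (g 0 1) / (ι (g 1 1) - ι (g 0 0)) : AlgebraicClosure F) : Line F),
      OnePoint.infty_ne_coe _, ?_⟩
    ext P
    induction P using OnePoint.rec with
    | infty => simp [smul_infty_eq_self, hc]
    | coe z =>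
      simp only [mem_fixedBy, smul_coe_eq_self, hc, map_zero, zero_mul, zero_add,
        Set.mem_insert_iff, OnePoint.coe_ne_infty, Set.mem_singleton_iff, OnePoint.coe_eq_coe,
        false_or]
      rw [eq_div_iff had', sub_eq_zero, mul_comm]
  · obtain ⟨s, hs⟩ := IsAlgClosed.exists_pow_nat_eq (ι (tr g ^ 2 - 4)) (n := 2) (by simp)
    have h2 : (2 : AlgebraicClosure F) ≠ 0 := by
      rw [← map_ofNat (algebraMap F (AlgebraicClosure F)) 2]
      simpa using NeZero.ne (2 : F)
    have hs0 : s ≠ 0 := fun h => hg <| by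
      rw [h, zero_pow two_ne_zero, eq_comm, map_eq_zero] at hs
      exact sub_eq_zero.1 hs
    have hc' : ι (g 1 0) ≠ 0 := by simpa using hc
    have hd' : ι (g 0 0) * ι (g 1 1) - ι (g 0 1) * ι (g 1 0) = 1 := by
      rw [← map_mul, ← map_mul, ← map_sub, det_eq, map_one]
    have hs' : s ^ 2 = (ι (g 0 0) + ι (g 1 1)) ^ 2 - 4 := by 
      rw [hs, tr, map_sub, map_pow, map_add, map_ofNat]
    refine ⟨(((ι (g 0 0) - ι (g 1 1) + s) / (2 * ι (g 1 0)) : AlgebraicClosure F) : Line F),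
      (((ι (g 0 0) - ι (g 1 1) - s) / (2 * ι (g 1 0)) : AlgebraicClosure F) : Line F), ?_, ?_⟩
    · rw [Ne, OnePoint.coe_eq_coe, div_left_inj' (mul_ne_zero h2 hc')]
      intro h
      exact mul_ne_zero h2 hs0 (by linear_combination h)
    ext P
    induction P using OnePoint.rec with
    | infty => simp [smul_infty_eq_self, hc]
    | coe z =>
      simp only [mem_fixedBy, smul_coe_eq_self,
        Set.mem_insert_iff, Set.mem_singleton_iff, OnePoint.coe_eq_coe]
      rw [eq_div_iff (mul_ne_zero h2 hc'), eq_div_iff (mul_ne_zero h2 hc'),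
        ← sub_eq_zero (b := ι (g 0 0) - ι (g 1 1) + s),
        ← sub_eq_zero (b := ι (g 0 0) - ι (g 1 1) - s), ← mul_eq_zero]
      constructor
      · intro h
        linear_combination 4 * ι (g 1 0) * h - hs' - 4 * hd'
      · intro h
        refine (mul_eq_zero.1 (?_ : (2 * 2 * ι (g 1 0)) * _ = 0)).resolve_left
          (mul_ne_zero (mul_ne_zero h2 h2) hc')
        linear_combination h + hs' + 4 * hd'

/-- A proper subgroup of `SL(2, p)` fixes a point of the projective line, or preserves a pair of
points, or has all its elements of order at most `5` modulo the center. -/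
theorem trichotomy {p : ℕ} [Fact p.Prime] (hp : p ≠ 2) {H : Subgroup SL(2, ZMod p)}
    (hH : H ≠ ⊤) :
    (∃ P : Line (ZMod p), ∀ g ∈ H, g • P = P) ∨
    (∃ P Q : Line (ZMod p), P ≠ Q ∧ (∀ g ∈ H, g • P = P ∨ g • P = Q) ∧
      (∀ g ∈ H, g • Q = P ∨ g • Q = Q) ∧
      ∀ g ∈ H, g ^ 2 ∉ Subgroup.center SL(2, ZMod p) → g • P = P ∧ g • Q = Q) ∨
    ∀ g ∈ H, ∃ k, 0 < k ∧ k ≤ 5 ∧ g ^ k ∈ Subgroup.center SL(2, ZMod p) := by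
  have h2 : (2 : ZMod p) ≠ 0 := Ring.two_ne_zero (by rwa [ZMod.ringChar_zmod_n])
  have : NeZero (2 : ZMod p) := ⟨h2⟩
  by_cases hu : ∃ u ∈ H, tr u ^ 2 = 4 ∧ u ∉ Subgroup.center SL(2, ZMod p)
  · obtain ⟨u, hu, hut, huc⟩ := hu
    obtain ⟨k, hk⟩ := exists_conj_upper_triangular hp hH hu hut huc
    refine .inl ⟨k⁻¹ • (∞ : Line (ZMod p)), fun g hg => ?_⟩
    rw [← mul_smul, ← smul_left_cancel_iff k, ← mul_smul, smul_inv_smul, ← mul_assoc]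
    exact (smul_infty_eq_self _).2 (hk g hg)
  have htr : ∀ g ∈ H, g ∉ Subgroup.center SL(2, ZMod p) → tr g ^ 2 ≠ 4 :=
    fun g hg hgc h => hu ⟨g, hg, h, hgc⟩
  set Z := (Subgroup.center SL(2, ZMod p)).subgroupOf H with hZ
  have hmemZ : ∀ g : H, g ∈ Z ↔ (g : SL(2, ZMod p)) ∈ Subgroup.center SL(2, ZMod p) :=
    fun g => Subgroup.mem_subgroupOf
  let X : SubMulAction H (Line (ZMod p)) :=
    { carrier := {P | ∃ g : H, g ∉ Z ∧ g • P = P}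
      smul_mem' := by
        rintro k P ⟨g, hg, hgP⟩
        refine ⟨k * g * k⁻¹, fun h => hg ?_, ?_⟩
        · simpa [mul_assoc] using (inferInstance : Z.Normal).conj_mem _ h k⁻¹
        · rw [mul_smul, inv_smul_smul, mul_smul, hgP] }
  have hcard : ∀ g : H, g ∉ Z → (fixedBy (Line (ZMod p)) (g : SL(2, ZMod p))).ncard = 2 :=
    fun g hg => card_fixedBy_line (htr g g.2 (by rwa [← hmemZ]))
  have hXfin : Finite X := by
    have : (⋃ g : {g : H // g ∉ Z}, fixedBy (Line (ZMod p)) (g.1 : SL(2, ZMod p))).Finite :=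
      Set.finite_iUnion fun g => Set.finite_of_ncard_ne_zero (by rw [hcard g.1 g.2]; simp)
    refine (this.subset ?_ : (X : Set (Line (ZMod p))).Finite).to_subtype
    rintro P ⟨g, hg, hgP⟩
    exact Set.mem_iUnion.2 ⟨⟨g, hg⟩, hgP⟩
  have hXcard : ∀ g ∉ Z, Nat.card (fixedBy X g) = 2 := fun g hg => by
    refine Eq.trans ?_ (hcard g hg)
    rw [← Nat.card_coe_set_eq]
    refine Nat.card_congr ⟨fun P => ⟨P.1.1, congrArg Subtype.val P.2⟩,
      fun P => ⟨⟨P.1, g, hg, P.2⟩, Subtype.ext P.2⟩, fun _ => rfl, fun _ => rfl⟩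
  rcases two_fixed_points_trichotomy (X := X) (Z := Z)
    (fun g hg x => Subtype.ext (smul_eq_self_of_mem_center ((hmemZ g).1 hg) _)) hXcard
    (fun x => by
      obtain ⟨g, hg, hgx⟩ := x.2
      exact ⟨g, hg, Subtype.ext hgx⟩) with ⟨x, hx⟩ | ⟨x, y, hxy, hx, hy, hs⟩ | h
  · exact .inl ⟨x, fun g hg => congrArg Subtype.val (hx ⟨g, hg⟩)⟩
  · refine .inr (.inl ⟨x, y, fun h => hxy (Subtype.ext h), fun g hg => ?_, fun g hg => ?_,
      fun g hg hg2 => ?_⟩)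
    · exact (hx ⟨g, hg⟩).imp (congrArg Subtype.val) (congrArg Subtype.val)
    · exact (hy ⟨g, hg⟩).imp (congrArg Subtype.val) (congrArg Subtype.val)
    · exact (hs ⟨g, hg⟩ hg2).imp (congrArg Subtype.val) (congrArg Subtype.val)
  · refine .inr (.inr fun g hg => ?_)
    obtain ⟨k, hk0, hk5, hk⟩ := h ⟨g, hg⟩
    exact ⟨k, hk0, hk5, hk⟩

open Polynomial in
/-- The polynomial whose roots are the traces of the noncentral elements of order at most `5`
modulo the center. -/
noncomputable def lowPoly (F : Type*) [Field F] : F[X] :=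
  X * ((X ^ 2 - C 1) * ((X ^ 2 - C 2) * (X ^ 4 - C 3 * X ^ 2 + C 1)))

theorem natDegree_lowPoly : (lowPoly F).natDegree = 9 := by
  rw [lowPoly]
  compute_degree!

theorem lowPoly_ne_zero : lowPoly F ≠ 0 := fun h => by
  have := natDegree_lowPoly (F := F)
  simp [h] at this

theorem mem_roots_lowPoly {t : F} :
    t ∈ (lowPoly F).roots ↔ t * ((t ^ 2 - 1) * ((t ^ 2 - 2) * (t ^ 4 - 3 * t ^ 2 + 1))) = 0 := by
  rw [Polynomial.mem_roots lowPoly_ne_zero]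
  simp [lowPoly]

theorem card_roots_lowPoly [DecidableEq F] : (lowPoly F).roots.toFinset.card ≤ 9 :=
  (Multiset.toFinset_card_le _).trans ((Polynomial.card_roots' _).trans_eq natDegree_lowPoly)

theorem mem_center_or_of_smul_sub {g h : SL(2, F)} {u v : F}
    (hh : ∀ i j, h i j = u * g i j - v * (1 : SL(2, F)) i j)
    (hc : h ∈ Subgroup.center SL(2, F)) : g ∈ Subgroup.center SL(2, F) ∨ u = 0 := by
  by_cases hu : u = 0
  · exact .inr hu
  obtain ⟨h1, h2, h3⟩ := (mem_center_iff h).1 hc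
  rw [hh] at h1 h2 h3
  rw [hh] at h3
  left
  refine (mem_center_iff g).2 ⟨?_, ?_, ?_⟩
  · simpa [hu] using h1
  · simpa [hu] using h2
  · simpa [hu] using h3

theorem mul_apply_of_smul_sub {g h : SL(2, F)} {u v : F}
    (hh : ∀ i j, h i j = u * g i j - v * (1 : SL(2, F)) i j) (i j : Fin 2) :
    (h * g) i j = (u * tr g - v) * g i j - u * (1 : SL(2, F)) i j := by
  have hd := det_eq g
  rw [mul_apply, hh, hh, tr]
  fin_cases i <;> fin_cases j <;> simp <;> first | ring1 | linear_combination u * (-hd)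

theorem mem_center_or_mem_roots_lowPoly {g : SL(2, F)} {k : ℕ} (hk0 : 0 < k) (hk : k ≤ 5)
    (hg : g ^ k ∈ Subgroup.center SL(2, F)) :
    g ∈ Subgroup.center SL(2, F) ∨ tr g ∈ (lowPoly F).roots := by
  have h1 : ∀ i j, (g ^ 1) i j = 1 * g i j - 0 * (1 : SL(2, F)) i j := fun i j => by simp
  have h2 := mul_apply_of_smul_sub h1
  have h3 := mul_apply_of_smul_sub h2
  have h4 := mul_apply_of_smul_sub h3
  have h5 := mul_apply_of_smul_sub h4
  simp only [← pow_succ, Nat.reduceAdd] at h2 h3 h4 h5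
  rw [mem_roots_lowPoly]
  interval_cases k
  · exact (mem_center_or_of_smul_sub h1 hg).imp_right fun h => absurd h one_ne_zero
  · refine (mem_center_or_of_smul_sub h2 hg).imp_right fun h => ?_
    grind
  · refine (mem_center_or_of_smul_sub h3 hg).imp_right fun h => ?_
    grind
  · refine (mem_center_or_of_smul_sub h4 hg).imp_right fun h => ?_
    grind
  · refine (mem_center_or_of_smul_sub h5 hg).imp_right fun h => ?_
    grind

theorem eq_of_smul_eq_self {g : SL(2, F)} (h10 : g 1 0 = 0) (hd : g 0 0 ≠ g 1 1) {P : Line F}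
    (hP : g • P = P) :
    P = ∞ ∨ P = ((ι (g 0 1 / (g 1 1 - g 0 0)) : AlgebraicClosure F) : Line F) := by
  have hd' : ι (g 1 1) - ι (g 0 0) ≠ 0 := sub_ne_zero.2 fun h =>
    hd ((algebraMap F (AlgebraicClosure F)).injective h).symm
  induction P using OnePoint.rec with
  | infty => exact .inl rfl
  | coe z =>
    rw [smul_coe_eq_self, h10] at hP
    right
    rw [OnePoint.coe_eq_coe, map_div₀, map_sub, eq_div_iff hd']
    linear_combination hP - z ^ 2 * map_zero ι

section Count

variable {p : ℕ} [Fact p.Prime] {T : Set SL(2, ZMod p)}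

/-- The finite set of fixed points of `z`, together with the image of `∞` under `z`. -/
noncomputable def candidates (z : SL(2, F)) [DecidableEq F] : Finset F :=
  open Polynomial in
  insert (z 0 0 / z 1 0) (C (z 1 0) * X ^ 2 + C (z 1 1 - z 0 0) * X + C (-z 0 1)).roots.toFinset

theorem card_candidates [DecidableEq F] (z : SL(2, F)) : (candidates z).card ≤ 3 := by
  refine (Finset.card_insert_le _ _).trans (Nat.succ_le_succ ?_)
  exact (Multiset.toFinset_card_le _).trans
    ((Polynomial.card_roots' _).trans Polynomial.natDegree_quadratic_le)

theorem mem_candidates [DecidableEq F] {z : SL(2, F)} (hz : z 1 0 ≠ 0) {b : F}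
    (hb : z • ((ι b : AlgebraicClosure F) : Line F) = ((ι b : AlgebraicClosure F) : Line F) ∨
      z • (∞ : Line F) = ((ι b : AlgebraicClosure F) : Line F)) : b ∈ candidates z := by
  rw [candidates, Finset.mem_insert, Multiset.mem_toFinset]
  rcases hb with hb | hb
  · right
    rw [smul_coe_eq_self, ← map_sub, ← map_pow, ← map_mul, ← map_mul, ← map_add, ← map_sub,
      map_eq_zero] at hb
    rw [Polynomial.mem_roots (fun h => hz ?_)]
    · simp only [Polynomial.IsRoot.def, Polynomial.eval_add, Polynomial.eval_mul,
        Polynomial.eval_C, Polynomial.eval_pow, Polynomial.eval_X]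
      linear_combination hb
    · simpa using congrArg (Polynomial.coeff · 2) h
  · left
    rw [smul_infty_eq_coe, ← map_mul] at hb
    rw [eq_div_iff hz, mul_comm]
    exact (algebraMap F (AlgebraicClosure F)).injective hb.2

theorem mem_of_upper (hp : p ≠ 2) (hT : IsCoclique T) {y z : SL(2, ZMod p)} (hy : y ∈ T)
    (hz : z ∈ T) (hz10 : z 1 0 ≠ 0) (hy10 : y 1 0 = 0) :
    y ∈ Subgroup.center SL(2, ZMod p) ∨ tr y ∈ (lowPoly (ZMod p)).roots ∨
      y 0 0 ≠ y 1 1 ∧ y 0 1 / (y 1 1 - y 0 0) ∈ candidates z := by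
  by_cases hyc : y ∈ Subgroup.center SL(2, ZMod p)
  · exact .inl hyc
  by_cases hyr : tr y ∈ (lowPoly (ZMod p)).roots
  · exact .inr (.inl hyr)
  have hlow : ∀ k, 0 < k → k ≤ 5 → y ^ k ∉ Subgroup.center SL(2, ZMod p) := fun k h0 h5 h =>
    (mem_center_or_mem_roots_lowPoly h0 h5 h).elim hyc hyr
  have hH := hT y hy z hz
  have hyH : y ∈ Subgroup.closure {y, z} := Subgroup.subset_closure (by simp)
  have hzH : z ∈ Subgroup.closure {y, z} := Subgroup.subset_closure (by simp)
  have hd : y 0 0 ≠ y 1 1 := fun hd => hH <|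
    eq_top_of_unipotent_mem hp hyH hzH hy10 hd (fun h => hyc ((mem_center_iff y).2 ⟨h, hy10, hd⟩))
      hz10
  refine .inr (.inr ⟨hd, mem_candidates hz10 ?_⟩)
  have hzi : z • (∞ : Line (ZMod p)) ≠ ∞ := fun h => hz10 ((smul_infty_eq_self z).1 h)
  rcases trichotomy hp hH with ⟨P, hP⟩ | ⟨P, Q, hPQ, h1, h2, h3⟩ | h
  · rcases eq_of_smul_eq_self hy10 hd (hP y hyH) with rfl | rfl
    · exact absurd (hP z hzH) hzi
    · exact .inl (hP z hzH)
  · obtain ⟨hyP, hyQ⟩ := h3 y hyH (hlow 2 (by norm_num) (by norm_num))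
    rcases eq_of_smul_eq_self hy10 hd hyP with rfl | rfl <;>
    rcases eq_of_smul_eq_self hy10 hd hyQ with rfl | rfl
    · exact absurd rfl hPQ
    · exact .inr ((h1 z hzH).resolve_left hzi)
    · exact .inr ((h2 z hzH).resolve_right hzi)
    · exact absurd rfl hPQ
  · obtain ⟨k, hk0, hk5, hk⟩ := h y hyH
    exact absurd hk (hlow k hk0 hk5)

theorem tr_mem_of_diagonal (hp : p ≠ 2) (hT : IsCoclique T) {x y : SL(2, ZMod p)} (hx : x ∈ T)
    (hy : y ∈ T) (hx01 : x 0 1 = 0) (hx10 : x 1 0 = 0)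
    (hx2 : x ^ 2 ∉ Subgroup.center SL(2, ZMod p)) (hy01 : y 0 1 ≠ 0) (hy10 : y 1 0 ≠ 0) :
    tr y ∈ (lowPoly (ZMod p)).roots ∧ tr (x * y) ∈ (lowPoly (ZMod p)).roots := by
  have hH := hT x hx y hy
  have hxH : x ∈ Subgroup.closure {x, y} := Subgroup.subset_closure (by simp)
  have hyH : y ∈ Subgroup.closure {x, y} := Subgroup.subset_closure (by simp)
  have hd : x 0 0 ≠ x 1 1 := fun hd => hx2 (pow_mem ((mem_center_iff x).2 ⟨hx01, hx10, hd⟩) 2)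
  have hfix : ∀ P : Line (ZMod p), x • P = P → P = ∞ ∨ P = ((0 : AlgebraicClosure (ZMod p))) :=
    fun P hP => by simpa [hx01] using eq_of_smul_eq_self hx10 hd hP
  have hyi : y • (∞ : Line (ZMod p)) ≠ ∞ := fun h => hy10 ((smul_infty_eq_self y).1 h)
  have hy0 : y • ((0 : AlgebraicClosure (ZMod p)) : Line (ZMod p)) ≠
      (0 : AlgebraicClosure (ZMod p)) := fun h => hy01 (by
    simpa using (smul_coe_eq_self y 0).1 h)
  have hswap : y • (∞ : Line (ZMod p)) = (0 : AlgebraicClosure (ZMod p)) →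
      y • ((0 : AlgebraicClosure (ZMod p)) : Line (ZMod p)) = ∞ →
      tr y ∈ (lowPoly (ZMod p)).roots ∧ tr (x * y) ∈ (lowPoly (ZMod p)).roots := fun h1 h2 => by
    have h00 : y 0 0 = 0 := by simpa using ((smul_infty_eq_coe y 0).1 h1).2.symm
    have h11 : y 1 1 = 0 := by simpa using (smul_coe_eq_infty y 0).1 h2
    constructor <;> rw [mem_roots_lowPoly] <;> simp [tr, mul_apply, h00, h11, hx01, hx10]
  rcases trichotomy hp hH with ⟨P, hP⟩ | ⟨P, Q, hPQ, h1, h2, h3⟩ | h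
  · rcases hfix P (hP x hxH) with rfl | rfl
    · exact absurd (hP y hyH) hyi
    · exact absurd (hP y hyH) hy0
  · obtain ⟨hxP, hxQ⟩ := h3 x hxH hx2
    rcases hfix P hxP with rfl | rfl <;> rcases hfix Q hxQ with rfl | rfl
    · exact absurd rfl hPQ
    · exact hswap ((h1 y hyH).resolve_left hyi) ((h2 y hyH).resolve_right hy0)
    · exact hswap ((h2 y hyH).resolve_right hyi) ((h1 y hyH).resolve_left hy0)
    · exact absurd rfl hPQ
  · have key : ∀ g ∈ Subgroup.closure {x, y}, g 0 1 ≠ 0 → tr g ∈ (lowPoly (ZMod p)).roots :=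
      fun g hg hg01 => by
        obtain ⟨k, hk0, hk5, hk⟩ := h g hg
        exact (mem_center_or_mem_roots_lowPoly hk0 hk5 hk).resolve_left
          fun hc => hg01 ((mem_center_iff g).1 hc).1
    refine ⟨key y hyH hy01, key _ (mul_mem hxH hyH) ?_⟩
    rw [mul_apply, hx01, zero_mul, add_zero]
    refine mul_ne_zero (fun h0 => ?_) hy01
    have := det_eq x
    simp [h0, hx01] at this

theorem eq_inv_of_apply_one_zero {y : SL(2, F)} (hy : y 1 0 = 0) : y 1 1 = (y 0 0)⁻¹ := by
  have := det_eq y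
  rw [hy, mul_zero, sub_zero] at this
  exact eq_inv_of_mul_eq_one_right this

theorem ext_of_apply_one_zero {y y' : SL(2, F)} (hy : y 1 0 = 0) (hy' : y' 1 0 = 0)
    (h00 : y 0 0 = y' 0 0) (h01 : y 0 1 = y' 0 1) : y = y' :=
  ext' h00 h01 (hy.trans hy'.symm) (by
    rw [eq_inv_of_apply_one_zero hy, eq_inv_of_apply_one_zero hy', h00])

/-- The eigenvalues, in the ground field, of the elements whose trace is a root of `lowPoly`. -/
noncomputable def lowEigenvalues (F : Type*) [Field F] [DecidableEq F] : Finset F :=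
  open Polynomial in
  (lowPoly F).roots.toFinset.biUnion fun t => (C 1 * X ^ 2 + C (-t) * X + C 1).roots.toFinset

theorem card_lowEigenvalues [DecidableEq F] : (lowEigenvalues F).card ≤ 18 :=
  (Finset.card_biUnion_le_card_mul _ _ 2 fun _ _ => (Multiset.toFinset_card_le _).trans
    ((Polynomial.card_roots' _).trans Polynomial.natDegree_quadratic_le)).trans
    (Nat.mul_le_mul_right 2 card_roots_lowPoly)

theorem mem_lowEigenvalues [DecidableEq F] {y : SL(2, F)} (hy : y 1 0 = 0)
    (ht : tr y ∈ (lowPoly F).roots) : y 0 0 ∈ lowEigenvalues F := by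
  rw [lowEigenvalues, Finset.mem_biUnion]
  refine ⟨tr y, Multiset.mem_toFinset.2 ht, ?_⟩
  rw [Multiset.mem_toFinset, Polynomial.mem_roots (fun h => one_ne_zero (α := F) ?_)]
  · have := det_eq y
    simp only [Polynomial.IsRoot.def, Polynomial.eval_add, Polynomial.eval_mul,
      Polynomial.eval_C, Polynomial.eval_pow, Polynomial.eval_X, tr]
    linear_combination -this - y 0 1 * hy
  · simpa [Polynomial.coeff_one] using congrArg (Polynomial.coeff · 2) h

theorem ncard_upper_le (hp : p ≠ 2) (hT : IsCoclique T) {z : SL(2, ZMod p)} (hz : z ∈ T)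
    (hz10 : z 1 0 ≠ 0) : {y ∈ T | y 1 0 = 0}.ncard ≤ 18 * p + 3 * (p - 3) + 2 := by
  have h2 : (2 : ZMod p) ≠ 0 := Ring.two_ne_zero (by rwa [ZMod.ringChar_zmod_n])
  have h3 : ({0, 1, -1} : Finset (ZMod p)).card = 3 := by
    rw [Finset.card_eq_three]
    refine ⟨0, 1, -1, by simp, by simp, fun h => h2 ?_, rfl⟩
    linear_combination h
  set S : Finset (ZMod p × ZMod p) := lowEigenvalues (ZMod p) ×ˢ Finset.univ ∪
    (candidates z ×ˢ ({0, 1, -1} : Finset (ZMod p))ᶜ).image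
      (fun q => (q.2, q.1 * (q.2⁻¹ - q.2))) ∪ {(1, 0), (-1, 0)} with hS
  have hcard : S.card ≤ 18 * p + 3 * (p - 3) + 2 := by
    refine (Finset.card_union_le _ _).trans (Nat.add_le_add
      ((Finset.card_union_le _ _).trans (Nat.add_le_add ?_ (Finset.card_image_le.trans ?_)))
      Finset.card_le_two)
    · rw [Finset.card_product, Finset.card_univ, ZMod.card]
      exact Nat.mul_le_mul_right _ card_lowEigenvalues
    · rw [Finset.card_product, Finset.card_compl, ZMod.card, h3]
      exact Nat.mul_le_mul_right _ (card_candidates z)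
  refine le_trans ?_ hcard
  rw [← Set.ncard_coe_finset]
  refine Set.ncard_le_ncard_of_injOn (fun y => (y 0 0, y 0 1)) ?_ ?_
  · rintro y ⟨hy, hy10⟩
    have hd := det_eq y
    have hinv := eq_inv_of_apply_one_zero hy10
    rw [Finset.mem_coe, hS, Finset.mem_union, Finset.mem_union]
    rcases mem_of_upper hp hT hy hz hz10 hy10 with h | h | ⟨hne, h⟩
    · obtain ⟨h01, -, h⟩ := (mem_center_iff y).1 h
      rw [← h, hy10, mul_zero, sub_zero, mul_self_eq_one_iff] at hd
      right
      rcases hd with hd | hd <;> simp [hd, h01]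
    · exact .inl (.inl (Finset.mem_product.2 ⟨mem_lowEigenvalues hy10 h, Finset.mem_univ _⟩))
    · refine .inl (.inr (Finset.mem_image.2 ⟨(_, y 0 0), Finset.mem_product.2 ⟨h, ?_⟩, ?_⟩))
      · simp only [Finset.mem_compl, Finset.mem_insert, Finset.mem_singleton, not_or]
        rw [hinv] at hne
        refine ⟨fun h => ?_, fun h => ?_, fun h => ?_⟩ <;> simp [h] at hne
      · rw [Prod.mk.injEq, ← hinv, div_mul_cancel₀ _ (sub_ne_zero.2 hne.symm)]
        exact ⟨rfl, rfl⟩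
  · rintro y ⟨-, hy10⟩ y' ⟨-, hy10'⟩ h
    exact ext_of_apply_one_zero hy10 hy10' (congrArg Prod.fst h) (congrArg Prod.snd h)

theorem ncard_generic_le (hp : p ≠ 2) (hT : IsCoclique T) {x : SL(2, ZMod p)} (hx : x ∈ T)
    (hx01 : x 0 1 = 0) (hx10 : x 1 0 = 0) (hx2 : x ^ 2 ∉ Subgroup.center SL(2, ZMod p)) :
    {y ∈ T | y 0 1 ≠ 0 ∧ y 1 0 ≠ 0}.ncard ≤ 81 * (p - 1) := by
  have hd : x 0 0 ≠ x 1 1 := fun hd => hx2 (pow_mem ((mem_center_iff x).2 ⟨hx01, hx10, hd⟩) 2)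
  set R := (lowPoly (ZMod p)).roots.toFinset with hR
  have hcard : ((R ×ˢ R) ×ˢ ({0} : Finset (ZMod p))ᶜ).card ≤ 81 * (p - 1) := by
    rw [Finset.card_product, Finset.card_product, Finset.card_compl, ZMod.card,
      Finset.card_singleton]
    exact Nat.mul_le_mul_right _ (Nat.mul_le_mul card_roots_lowPoly card_roots_lowPoly)
  refine le_trans ?_ hcard
  rw [← Set.ncard_coe_finset]
  refine Set.ncard_le_ncard_of_injOn (fun y => ((tr y, tr (x * y)), y 0 1)) ?_ ?_
  · rintro y ⟨hy, hy01, hy10⟩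
    obtain ⟨h1, h2⟩ := tr_mem_of_diagonal hp hT hx hy hx01 hx10 hx2 hy01 hy10
    simp [hR, h1, h2, hy01, -Polynomial.mem_roots']
  · rintro y ⟨-, hy01, -⟩ y' ⟨-, hy01', -⟩ h
    simp only [Prod.mk.injEq] at h
    obtain ⟨⟨h1, h2⟩, h3⟩ := h
    simp only [tr, mul_apply, hx01, hx10, zero_mul, add_zero, zero_add] at h1 h2
    have h00 : y 0 0 = y' 0 0 := by
      refine mul_left_cancel₀ (sub_ne_zero.2 hd) ?_
      linear_combination h2 - x 1 1 * h1
    have h11 : y 1 1 = y' 1 1 := by linear_combination h1 - h00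
    refine ext' h00 h3 (mul_left_cancel₀ hy01 ?_) h11
    have := det_eq y
    have := det_eq y'
    rw [← h00, ← h11, ← h3] at this
    grind

end Count

theorem _root_.IsCoclique.image {G G' : Type*} [Group G] [Group G'] {A : Set G}
    (hA : IsCoclique A) (e : G ≃* G') : IsCoclique (e '' A) := by
  rintro _ ⟨g, hg, rfl⟩ _ ⟨h, hh, rfl⟩ htop
  refine hA g hg h hh (Subgroup.map_injective (f := e.toMonoidHom) e.injective ?_)
  rw [MonoidHom.map_closure, Subgroup.map_top_of_surjective _ e.surjective, ← htop, Set.image_pair]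
  rfl

theorem ncard_le {p : ℕ} [Fact p.Prime] (hp : 5 ≤ p) {T : Set SL(2, ZMod p)} (hT : IsCoclique T)
    (hfix : ∀ P : Line (ZMod p), ∃ y ∈ T, y • P ≠ P) {x : SL(2, ZMod p)} (hx : x ∈ T)
    (hx01 : x 0 1 = 0) (hx10 : x 1 0 = 0) (hx2 : x ^ 2 ∉ Subgroup.center SL(2, ZMod p)) :
    T.ncard ≤ 129 * (p - 1) + 4 := by
  have hp2 : p ≠ 2 := by omega
  set w : SL(2, ZMod p) := mk 0 (-1) 1 0 (by simp) with hw
  set c := MulAut.conj w with hc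
  have hc10 : ∀ y, c y 1 0 = -y 0 1 := fun y => by
    simp [hc, hw, mul_apply, inv_apply_zero_zero, inv_apply_one_zero]
  have h1 : {y ∈ T | y 1 0 = 0}.ncard ≤ 18 * p + 3 * (p - 3) + 2 := by
    obtain ⟨z, hz, hzi⟩ := hfix ∞
    exact ncard_upper_le hp2 hT hz fun h => hzi ((smul_infty_eq_self z).2 h)
  have h2 : {y ∈ T | y 0 1 = 0}.ncard ≤ 18 * p + 3 * (p - 3) + 2 := by
    obtain ⟨z, hz, hz0⟩ := hfix (0 : AlgebraicClosure (ZMod p))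
    refine le_trans (Set.ncard_le_ncard_of_injOn c ?_ c.injective.injOn)
      (ncard_upper_le hp2 (hT.image c) ⟨z, hz, rfl⟩ fun h => hz0 ?_)
    · rintro y ⟨hy, hy01⟩
      exact ⟨⟨y, hy, rfl⟩, by rw [hc10, hy01, neg_zero]⟩
    · rw [hc10, neg_eq_zero] at h
      rw [smul_coe_eq_self, h]
      simp
  have h3 := ncard_generic_le hp2 hT hx hx01 hx10 hx2
  have hsub : T ⊆ ({y ∈ T | y 1 0 = 0} ∪ {y ∈ T | y 0 1 = 0}) ∪
      {y ∈ T | y 0 1 ≠ 0 ∧ y 1 0 ≠ 0} := fun y hy => by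
    by_cases h10 : y 1 0 = 0
    · exact .inl (.inl ⟨hy, h10⟩)
    by_cases h01 : y 0 1 = 0
    · exact .inl (.inr ⟨hy, h01⟩)
    exact .inr ⟨hy, h01, h10⟩
  have := Set.ncard_le_ncard hsub (Set.toFinite _)
  have := Set.ncard_union_le ({y ∈ T | y 1 0 = 0} ∪ {y ∈ T | y 0 1 = 0})
    {y ∈ T | y 0 1 ≠ 0 ∧ y 1 0 ≠ 0}
  have := Set.ncard_union_le {y ∈ T | y 1 0 = 0} {y ∈ T | y 0 1 = 0}
  omega

theorem pow_pred_eq_one_of_mem_center {p : ℕ} [Fact p.Prime] (hp : p ≠ 2) {x : SL(2, ZMod p)}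
    (hx : x ^ (p - 1) ∈ Subgroup.center SL(2, ZMod p))
    (hx2 : x ^ 2 ∉ Subgroup.center SL(2, ZMod p)) : x ^ (p - 1) = 1 := by
  have h2 : (2 : ZMod p) ≠ 0 := Ring.two_ne_zero (by rwa [ZMod.ringChar_zmod_n])
  obtain ⟨h01, h10, h11⟩ := (mem_center_iff _).1 hx
  have hd := det_eq (x ^ (p - 1))
  rw [h01, zero_mul, sub_zero, ← h11, mul_self_eq_one_iff] at hd
  rcases hd with hd | hd
  · exact ext' hd h01 h10 (h11 ▸ hd)
  · have ht : tr (x ^ p) = tr x := by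
      have := ZMod.trace_pow_card x.1
      rwa [ZMod.pow_card, trace_fin_two, trace_fin_two] at this
    rw [← pow_sub_one_mul (Fact.out : p.Prime).ne_zero, tr, tr, mul_apply, mul_apply,
      h01, h10, ← h11, hd] at ht
    have ht' : x 0 0 + x 1 1 = 0 := by
      refine (mul_eq_zero.1 (?_ : 2 * (x 0 0 + x 1 1) = 0)).resolve_left h2
      linear_combination -ht
    refine absurd ((mem_center_iff _).2 ⟨?_, ?_, ?_⟩) hx2 <;> rw [sq, mul_apply]
    · linear_combination x 0 1 * ht'
    · linear_combination x 1 0 * ht'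
    · rw [mul_apply]
      linear_combination (x 0 0 - x 1 1) * ht'

open Polynomial in
theorem exists_eigenvalue {p : ℕ} [Fact p.Prime] {x : SL(2, ZMod p)} (hx : x ^ (p - 1) = 1) :
    ∃ c : ZMod p, c ^ 2 - tr x * c + 1 = 0 := by
  set M := x.1
  have hM : M ^ p = M := by
    have h := pow_sub_one_mul (Fact.out : p.Prime).ne_zero x
    rw [hx, one_mul] at h
    exact congrArg Subtype.val h.symm
  have hdvd : minpoly (ZMod p) M ∣ X ^ p - X := minpoly.dvd _ _ (by simp [hM])
  have hs : (X ^ p - X : (ZMod p)[X]).Splits := by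
    simpa using FiniteField.splits_X_pow_card_sub_X (K := ZMod p) p
  obtain ⟨c, hc⟩ := (hs.of_dvd
    (FiniteField.X_pow_card_sub_X_ne_zero _ (Fact.out : p.Prime).one_lt) hdvd).exists_eval_eq_zero
    (minpoly.degree_pos (Matrix.isIntegral M)).ne'
  have := Polynomial.eval_eq_zero_of_dvd_of_eval_eq_zero (Matrix.minpoly_dvd_charpoly M) hc
  rw [Matrix.charpoly_fin_two, x.2, trace_fin_two] at this
  exact ⟨c, by simpa [tr, M] using this⟩

/-- An element of order dividing `p - 1` modulo the center, but not of order at most `2`, is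
diagonalizable. -/
theorem exists_conj_diagonal {p : ℕ} [Fact p.Prime] (hp : p ≠ 2) {x : SL(2, ZMod p)}
    (hx : x ^ (p - 1) ∈ Subgroup.center SL(2, ZMod p))
    (hx2 : x ^ 2 ∉ Subgroup.center SL(2, ZMod p)) :
    ∃ k : SL(2, ZMod p), (k * x * k⁻¹) 0 1 = 0 ∧ (k * x * k⁻¹) 1 0 = 0 := by
  have h2 : (2 : ZMod p) ≠ 0 := Ring.two_ne_zero (by rwa [ZMod.ringChar_zmod_n])
  have hx1 := pow_pred_eq_one_of_mem_center hp hx hx2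
  obtain ⟨c, hc⟩ := exists_eigenvalue hx1
  obtain ⟨k, hk⟩ : ∃ k : SL(2, ZMod p), (k * x * k⁻¹) 1 0 = 0 := by
    by_cases h10 : x 1 0 = 0
    · exact ⟨1, by simpa using h10⟩
    · refine ⟨mk 0 (-1) 1 (-((c - x 1 1) / x 1 0)) (by simp), ?_⟩
      have hd := det_eq x
      simp only [tr] at hc
      simp only [mul_apply, inv_apply_zero_zero, inv_apply_one_zero]
      simp
      field_simp
      linear_combination hd + hc
  set y := k * x * k⁻¹ with hy
  have hy1 : y ^ (p - 1) = 1 := by rw [hy, conj_pow, hx1]; simp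
  have hdiag : y 0 0 ≠ y 1 1 := fun h => hx2 <| by
    have hd := det_eq y
    rw [hk, ← h] at hd
    have hsq : y ^ 2 = upper (2 * y 0 0 * y 0 1) := by
      apply ext' <;> rw [sq, mul_apply] <;> simp [hk, ← h]
      · linear_combination hd
      · ring
      · linear_combination hd
    have hpow : (y ^ 2) ^ (p - 1) = 1 := by rw [← pow_mul, mul_comm, pow_mul, hy1, one_pow]
    rw [hsq, upper_pow, Nat.cast_sub (Fact.out : p.Prime).one_le] at hpow
    have h0 := congrArg (fun g : SL(2, ZMod p) => g 0 1) hpow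
    simp at h0
    have hyc : y ∈ Subgroup.center SL(2, ZMod p) := by
      refine (mem_center_iff y).2 ⟨?_, hk, h⟩
      rcases h0 with (h0 | h0) | h0
      · exact absurd h0 h2
      · simp [h0] at hd
      · exact h0
    have : x ∈ Subgroup.center SL(2, ZMod p) := by
      simpa [hy, mul_assoc] using (Subgroup.instNormalCenter).conj_mem _ hyc k⁻¹
    exact pow_mem this 2
  refine ⟨upper (y 0 1 / (y 0 0 - y 1 1)) * k, ?_⟩
  have hconj : upper (y 0 1 / (y 0 0 - y 1 1)) * k * x * (upper (y 0 1 / (y 0 0 - y 1 1)) * k)⁻¹ =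
      upper (y 0 1 / (y 0 0 - y 1 1)) * y * (upper (y 0 1 / (y 0 0 - y 1 1)))⁻¹ := by
    rw [hy]; group
  have hdiag' := sub_ne_zero.2 hdiag
  rw [hconj]
  simp [mul_apply, inv_apply_zero_zero, inv_apply_zero_one, inv_apply_one_zero,
      inv_apply_one_one, hk]
  field_simp
  ring

theorem exists_smul_ne (P : Line F) : ∃ g : SL(2, F), g • P ≠ P := by
  induction P using OnePoint.rec with
  | infty =>
    refine ⟨mk 0 (-1) 1 0 (by simp), fun h => ?_⟩
    rw [smul_infty_eq_self] at h
    simp at h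
  | coe z =>
    refine ⟨upper 1, fun h => ?_⟩
    rw [smul_coe_eq_self] at h
    simp at h

/-- The preimage in `SL(2, p)` of a maximal coclique of `PSL(2, p)` that is not a maximal subgroup
fixes no point of the projective line. -/
theorem exists_smul_ne_of_isMaximalCoclique {p : ℕ} [Fact p.Prime] {A : Set PSL(2, ZMod p)}
    (hA : IsMaximalCoclique A)
    (hnotmax : ∀ M : Subgroup PSL(2, ZMod p), IsCoatom M → A ≠ (M : Set PSL(2, ZMod p)))
    (P : Line (ZMod p)) :
    ∃ y ∈ ((↑) : SL(2, ZMod p) → PSL(2, ZMod p)) ⁻¹' A, y • P ≠ P := by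
  by_contra! hcon
  set π := QuotientGroup.mk' (Subgroup.center SL(2, ZMod p)) with hπ
  have hker : π.ker ≤ stabilizer SL(2, ZMod p) P := by
    rw [QuotientGroup.ker_mk']
    exact fun g hg => smul_eq_self_of_mem_center hg P
  have hne : (stabilizer SL(2, ZMod p) P).map π ≠ ⊤ := fun h => by
    obtain ⟨g, hg⟩ := exists_smul_ne P
    have hg' : g ∈ ((stabilizer SL(2, ZMod p) P).map π).comap π := by rw [h]; trivial
    rw [Subgroup.comap_map_eq_self hker] at hg'
    exact hg hg'
  obtain ⟨M, hM, hle⟩ := (eq_top_or_exists_le_coatom _).resolve_left hne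
  refine hnotmax M hM (hA.2 M (fun g hg h hh htop => hM.1 ?_) fun a ha => ?_)
  · rw [eq_top_iff, ← htop, Subgroup.closure_le]
    rintro y (rfl | rfl) <;> assumption
  · obtain ⟨y, rfl⟩ := QuotientGroup.mk'_surjective _ a
    exact hle ⟨y, hcon y ha, rfl⟩

theorem isCoclique_preimage {G : Type*} [Group G] {N : Subgroup G} [N.Normal] {A : Set (G ⧸ N)}
    (hA : IsCoclique A) : IsCoclique (((↑) : G → G ⧸ N) ⁻¹' A) := fun g hg h hh htop => by
  refine hA g hg h hh ?_
  have := congrArg (Subgroup.map (QuotientGroup.mk' N)) htop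
  rw [MonoidHom.map_closure, Set.image_pair,
    Subgroup.map_top_of_surjective _ (QuotientGroup.mk'_surjective N)] at this
  exact this

theorem two_mul_ncard_le {p : ℕ} [Fact p.Prime] (hp : p ≠ 2) (A : Set PSL(2, ZMod p)) :
    2 * A.ncard ≤ (((↑) : SL(2, ZMod p) → PSL(2, ZMod p)) ⁻¹' A).ncard := by
  have h2 : (2 : ZMod p) ≠ 0 := Ring.two_ne_zero (by rwa [ZMod.ringChar_zmod_n])
  rw [← Nat.card_coe_set_eq, ← Nat.card_coe_set_eq]
  refine (Nat.mul_le_mul_right _ ?_).trans_eq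
    (QuotientGroup.card_preimage_mk (Subgroup.center SL(2, ZMod p)) A).symm
  have hne : (-1 : SL(2, ZMod p)) ≠ 1 := fun h => h2 <| by
    have := congrArg (fun g : SL(2, ZMod p) => g 0 0) h
    simp at this
    linear_combination -this
  have hmem : (-1 : SL(2, ZMod p)) ∈ Subgroup.center SL(2, ZMod p) :=
    (mem_center_iff _).2 (by simp)
  have : Nontrivial (Subgroup.center SL(2, ZMod p)) :=
    ⟨⟨⟨-1, hmem⟩, 1, fun h => hne (congrArg Subtype.val h)⟩⟩
  exact Finite.one_lt_card

end SLTwo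

end SL2

theorem coclique_bound_main4b (p : ℕ) (hp : p.Prime) (hp2 : 2 < p)
    (A : Set PSL(2, ZMod p)) (hA : IsMaximalCoclique A)
    (hnotmax : ∀ M : Subgroup PSL(2, ZMod p), IsCoatom M → A ≠ (M : Set PSL(2, ZMod p)))
    (x : PSL(2, ZMod p)) (hxA : x ∈ A) (hx2 : 2 < orderOf x)
    (hxdvd : orderOf x ∣ p - 1)
    (hA5S4 : HasMaximalSubgroupIsoTo PSL(2, ZMod p) (alternatingGroup (Fin 5)) ∨
      HasMaximalSubgroupIsoTo PSL(2, ZMod p) (Equiv.Perm (Fin 4))) :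
    2 * A.ncard ≤ 129 * (p - 1) + 4 := by
  have : Fact p.Prime := ⟨hp⟩
  have hp5 : 5 ≤ p := by
    have := Nat.le_of_dvd (by omega) hxdvd
    have : p ≠ 4 := by rintro rfl; exact absurd hp (by norm_num)
    omega
  obtain ⟨y, rfl⟩ := QuotientGroup.mk'_surjective _ x
  have hmem : ∀ n, y ^ n ∈ Subgroup.center SL(2, ZMod p) ↔
      (QuotientGroup.mk' (Subgroup.center SL(2, ZMod p)) y) ^ n = 1 := fun n => by
    rw [← map_pow]
    exact (QuotientGroup.eq_one_iff _).symm
  have hy2 : y ^ 2 ∉ Subgroup.center SL(2, ZMod p) := fun h =>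
    absurd (orderOf_le_of_pow_eq_one two_pos ((hmem 2).1 h)) (by omega)
  obtain ⟨k, hk01, hk10⟩ := SLTwo.exists_conj_diagonal (by omega)
    ((hmem _).2 (orderOf_dvd_iff_pow_eq_one.1 hxdvd)) hy2
  set T := ((↑) : SL(2, ZMod p) → PSL(2, ZMod p)) ⁻¹' A with hT
  refine (SLTwo.two_mul_ncard_le (by omega) A).trans ?_
  rw [← hT, ← Set.ncard_image_of_injective T (MulAut.conj k).injective]
  refine SLTwo.ncard_le hp5 ((SLTwo.isCoclique_preimage hA.1).image (MulAut.conj k)) (fun P => ?_)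
    ⟨y, hxA, rfl⟩ hk01 hk10 fun h => hy2 ?_
  · obtain ⟨z, hz, hzP⟩ := SLTwo.exists_smul_ne_of_isMaximalCoclique hA hnotmax (k⁻¹ • P)
    refine ⟨_, ⟨z, hz, rfl⟩, fun h => hzP ?_⟩
    rw [MulAut.conj_apply, mul_smul, mul_smul] at h
    rw [eq_inv_smul_iff]
    exact h
  · rw [MulAut.conj_apply, conj_pow] at h
    simpa [mul_assoc] using (Subgroup.instNormalCenter).conj_mem _ h k⁻¹
end
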